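/- arXiv:1501.02463 — 3 statements merged into one kernel-verified Lean document; each statement's English description precedes it below -/
import Mathlib

section
/- Let L(u_1,…,u_σ) = Σ_{l∈Λ} a_l · contr^l(u_1^{(A_1,B_1)} ⊗ … ⊗ u_σ^{(A_σ,B_σ)}) be a finite linear combination of formal complete (or partial) contractions of degree σ, multilinear in symmetric tensor arguments u_j of type (A_j,B_j). If there exists an integer n ≥ σ such that L vanishes by substitution in dimension n — that is, the multilinear differential operator obtained by substituting the derivative tensor ∂^{(A_j,B_j)}ψ^j in place of u_j^{(A_j,B_j)} vanishes identically for all Ψ = (ψ^1,…,ψ^σ) ∈ C_c^∞(ℂ^n, ℝ^σ) — then L vanishes formally. -/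
open MeasureTheory

noncomputable section

namespace KahlerInv

/-- The Wirtinger holomorphic derivative `∂/∂z_a` on `ℂⁿ`. -/
def dz (n : ℕ) (a : Fin n) (f : (Fin n → ℂ) → ℂ) : (Fin n → ℂ) → ℂ :=
  fun z => (1 / 2 : ℂ) *
    (fderiv ℝ f z (Pi.single a 1) - Complex.I * fderiv ℝ f z (Pi.single a Complex.I))

/-- The Wirtinger anti-holomorphic derivative `∂/∂z̄_a` on `ℂⁿ`. -/
def dzbar (n : ℕ) (a : Fin n) (f : (Fin n → ℂ) → ℂ) : (Fin n → ℂ) → ℂ :=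
  fun z => (1 / 2 : ℂ) *
    (fderiv ℝ f z (Pi.single a 1) + Complex.I * fderiv ℝ f z (Pi.single a Complex.I))

/-- The iterated mixed Wirtinger derivative `∂^{(A,B)}` with the prescribed
holomorphic indices `hs` and anti-holomorphic indices `as`. -/
def mixedDeriv (n : ℕ) {A B : ℕ} (hs : Fin A → Fin n) (as : Fin B → Fin n)
    (f : (Fin n → ℂ) → ℂ) : (Fin n → ℂ) → ℂ :=
  (List.ofFn hs).foldr (fun a g => dz n a g)
    ((List.ofFn as).foldr (fun a g => dzbar n a g) f)

/-- `f : ℂⁿ → ℝ` is smooth and compactly supported. -/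
def SmoothCpt (n : ℕ) (f : (Fin n → ℂ) → ℝ) : Prop :=
  ContDiff ℝ (⊤ : ℕ∞) f ∧ HasCompactSupport f

/-- A formal (complete or partial) contraction of degree `σ`, with `p` free
holomorphic indices and `q` free anti-holomorphic indices.  The factor on
`ψ^j` carries `A j` holomorphic and `B j` anti-holomorphic index slots.
The bijection `pair` matches every holomorphic slot either with an
anti-holomorphic slot (a contracted pair) or with a free holomorphic label
in `Fin p`; a label `i : Fin q` on the left corresponds to the
anti-holomorphic slot `pair (Sum.inr i)`, which is the `i`-th free
anti-holomorphic index. -/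
structure Term (σ p q : ℕ) where
  A : Fin σ → ℕ
  B : Fin σ → ℕ
  pair : ((Σ j : Fin σ, Fin (A j)) ⊕ Fin q) ≃ ((Σ j : Fin σ, Fin (B j)) ⊕ Fin p)
  okq : ∀ i : Fin q, (pair (Sum.inr i)).isLeft
  okp : ∀ i : Fin p, (pair.symm (Sum.inr i)).isLeft

namespace Term

variable {σ p q : ℕ}

/-- The type of holomorphic index slots. -/
abbrev HoloIdx (T : Term σ p q) : Type := Σ j : Fin σ, Fin (T.A j)

/-- The type of anti-holomorphic index slots. -/
abbrev AntiIdx (T : Term σ p q) : Type := Σ j : Fin σ, Fin (T.B j)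

open Classical in
/-- Evaluation of a formal contraction on the tuple `Ψ` of functions, with
values `fh` (resp. `fa`) assigned to the free holomorphic (resp.
anti-holomorphic) indices, at the point `z`.  Each contracted pair of indices
is summed over `Fin n`. -/
def eval (n : ℕ) (T : Term σ p q) (Ψ : Fin σ → (Fin n → ℂ) → ℝ)
    (fh : Fin p → Fin n) (fa : Fin q → Fin n) (z : Fin n → ℂ) : ℂ :=
  ∑ v : (T.HoloIdx ⊕ Fin q) → Fin n,
    (if (∀ i : Fin q, v (Sum.inr i) = fa i) ∧
        (∀ (s : T.HoloIdx) (i : Fin p),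
          T.pair (Sum.inl s) = Sum.inr i → v (Sum.inl s) = fh i)
      then (1 : ℂ) else 0) *
    ∏ j : Fin σ,
      mixedDeriv n (fun s : Fin (T.A j) => v (Sum.inl ⟨j, s⟩))
        (fun t : Fin (T.B j) => v (T.pair.symm (Sum.inl ⟨j, t⟩)))
        (fun w => (Ψ j w : ℂ)) z

/-- The weight: the total number of contracted pairs. -/
def weight (T : Term σ p q) : ℕ := (∑ j, T.A j) - p

/-- The order `d = Σ_j (A_j + B_j - 4)`. -/
def order (T : Term σ p q) : ℕ := ∑ j, (T.A j + T.B j - 4)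

/-- Acceptability: every factor has `A_j, B_j ≥ 2`. -/
def Acceptable (T : Term σ p q) : Prop := ∀ j, 2 ≤ T.A j ∧ 2 ≤ T.B j

/-- No trace: no contracted pair has both indices in the same factor. -/
def NoTraces (T : Term σ p q) : Prop :=
  ∀ (s : T.HoloIdx) (t : T.AntiIdx), T.pair (Sum.inl s) = Sum.inl t → t.1 ≠ s.1

open Classical in
/-- The number of traces in factor `j`. -/
def tracesAt (T : Term σ p q) (j : Fin σ) : ℕ :=
  (Finset.univ.filter fun s : T.HoloIdx =>
    s.1 = j ∧ ∃ t : T.AntiIdx, T.pair (Sum.inl s) = Sum.inl t ∧ t.1 = j).card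

open Classical in
/-- The height: the total number of traces. -/
def height (T : Term σ p q) : ℕ :=
  (Finset.univ.filter fun s : T.HoloIdx =>
    ∃ t : T.AntiIdx, T.pair (Sum.inl s) = Sum.inl t ∧ t.1 = s.1).card

open Classical in
/-- The number of contractions of an anti-holomorphic index of factor `i`
against a holomorphic index of factor `j` (denoted `Ψ^i_ā Ψ^j_a`). -/
def specialCount (T : Term σ p q) (i j : Fin σ) : ℕ :=
  (Finset.univ.filter fun s : T.HoloIdx =>
    s.1 = j ∧ ∃ t : T.AntiIdx, T.pair (Sum.inl s) = Sum.inl t ∧ t.1 = i).card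

open Classical in
/-- The number of contracted pairs with one index in factor `u` and the
other in factor `v`. -/
def linkCount (T : Term σ p q) (u v : Fin σ) : ℕ :=
  (Finset.univ.filter fun s : T.HoloIdx =>
    ∃ t : T.AntiIdx, T.pair (Sum.inl s) = Sum.inl t ∧
      ((s.1 = u ∧ t.1 = v) ∨ (s.1 = v ∧ t.1 = u))).card

/-- `Π_l(h)`: the number of contractions `Ψ^1_ā Ψ^h_a` plus the number of
contractions `Ψ^h_ā Ψ^σ_a`. -/
def piCount (T : Term σ p q) (h : Fin σ) : ℕ :=
  T.specialCount ⟨0, h.pos⟩ h + T.specialCount h ⟨σ - 1, Nat.sub_lt h.pos Nat.one_pos⟩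

/-- The free index (holomorphic or anti-holomorphic) does not belong to
factor `i`. -/
def FreeNotIn (T : Term σ p q) (i : Fin σ) : Prop :=
  (∀ s : T.HoloIdx, (∃ l : Fin p, T.pair (Sum.inl s) = Sum.inr l) → s.1 ≠ i) ∧
  (∀ t : T.AntiIdx, (∃ l : Fin q, T.pair.symm (Sum.inl t) = Sum.inr l) → t.1 ≠ i)

end Term

/-- A restriction list `𝓛 ∈ {0,1,2}^{2σ}`. -/
structure RestrictionList (σ : ℕ) where
  α : Fin σ → ℕ
  β : Fin σ → ℕ
  hα : ∀ j, α j ≤ 2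
  hβ : ∀ j, β j ≤ 2

/-- `𝓛`-acceptability: `A_j ≥ α_j` and `B_j ≥ β_j` for every `j`. -/
def Term.LAcc {σ p q : ℕ} (T : Term σ p q) (𝓛 : RestrictionList σ) : Prop :=
  ∀ j, 𝓛.α j ≤ T.A j ∧ 𝓛.β j ≤ T.B j

/-- The order relative to a restriction list:
`d = Σ_j (A_j + B_j - α_j - β_j)`. -/
def Term.orderL {σ p q : ℕ} (T : Term σ p q) (𝓛 : RestrictionList σ) : ℕ :=
  ∑ j, (T.A j - 𝓛.α j + (T.B j - 𝓛.β j))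

/-- A finite linear combination of formal contractions of degree `σ` with
`p` free holomorphic and `q` free anti-holomorphic indices. -/
structure LinComb (σ p q : ℕ) where
  N : ℕ
  coeff : Fin N → ℂ
  term : Fin N → Term σ p q

/-- Evaluation of a linear combination of formal contractions. -/
def LinComb.eval (n : ℕ) {σ p q : ℕ} (L : LinComb σ p q)
    (Ψ : Fin σ → (Fin n → ℂ) → ℝ) (fh : Fin p → Fin n) (fa : Fin q → Fin n)
    (z : Fin n → ℂ) : ℂ :=
  ∑ i, L.coeff i * (L.term i).eval n Ψ fh fa z

open Classical in
/-- Evaluation of the sublinear combination consisting of the terms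
satisfying `P`. -/
def LinComb.evalIf (n : ℕ) {σ p q : ℕ} (L : LinComb σ p q) (P : Fin L.N → Prop)
    (Ψ : Fin σ → (Fin n → ℂ) → ℝ) (fh : Fin p → Fin n) (fa : Fin q → Fin n)
    (z : Fin n → ℂ) : ℂ :=
  ∑ i, if P i then L.coeff i * (L.term i).eval n Ψ fh fa z else 0

/-- The empty assignment of free indices. -/
def noFree {n : ℕ} : Fin 0 → Fin n := fun i => i.elim0

/-- The scalar invariant `L` integrates to zero in dimension `n`. -/
def IntegratesToZero (n : ℕ) {σ : ℕ} (L : LinComb σ 0 0) : Prop :=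
  ∀ Ψ : Fin σ → (Fin n → ℂ) → ℝ, (∀ j, SmoothCpt n (Ψ j)) →
    ∫ z : Fin n → ℂ, L.eval n Ψ noFree noFree z = 0

/-- The scalar invariant `L(φ)` of a single function integrates to zero in
dimension `n`. -/
def IntegratesToZeroPhi (n : ℕ) {σ : ℕ} (L : LinComb σ 0 0) : Prop :=
  ∀ φ : (Fin n → ℂ) → ℝ, SmoothCpt n φ →
    ∫ z : Fin n → ℂ, L.eval n (fun _ => φ) noFree noFree z = 0

/-- The divergence `∂_ā T_a` of a `(1,0)`-form valued invariant. -/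
def divHolo (n : ℕ) {σ : ℕ} (T : LinComb σ 1 0)
    (Ψ : Fin σ → (Fin n → ℂ) → ℝ) (z : Fin n → ℂ) : ℂ :=
  ∑ a : Fin n, dzbar n a (fun w => T.eval n Ψ (fun _ => a) noFree w) z

/-- The divergence `∂_a T_ā` of a `(0,1)`-form valued invariant. -/
def divAnti (n : ℕ) {σ : ℕ} (T : LinComb σ 0 1)
    (Ψ : Fin σ → (Fin n → ℂ) → ℝ) (z : Fin n → ℂ) : ℂ :=
  ∑ a : Fin n, dz n a (fun w => T.eval n Ψ noFree (fun _ => a) w) z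

/-- Two formal contractions are formally equal if their index pairings can be
made to coincide by permuting the (barred, resp. unbarred) index slots on each
factor. -/
def FormallyEq {σ p q : ℕ} (T T' : Term σ p q) : Prop :=
  ∃ (e : T.HoloIdx ≃ T'.HoloIdx) (f : T.AntiIdx ≃ T'.AntiIdx),
    (∀ s : T.HoloIdx, (e s).1 = s.1) ∧ (∀ t : T.AntiIdx, (f t).1 = t.1) ∧
    ∀ x : T.HoloIdx ⊕ Fin q,
      T'.pair (Sum.map (fun s => e s) id x) = Sum.map (fun t => f t) id (T.pair x)

open Classical in
/-- A linear combination of formal contractions vanishes formally: after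
grouping formally equal contractions, all coefficients cancel. -/
def VanishesFormally {σ p q : ℕ} (L : LinComb σ p q) : Prop :=
  ∀ T₀ : Term σ p q,
    (∑ i : Fin L.N, if FormallyEq (L.term i) T₀ then L.coeff i else 0) = 0

/-- `T'` arises from `T` by erasing all the contracted pairs joining the
factors `u` and `v`. -/
def ErasesLinks {σ : ℕ} (u v : Fin σ) (T T' : Term σ 0 0) : Prop :=
  ∃ (e : T'.HoloIdx ↪ T.HoloIdx) (f : T'.AntiIdx ↪ T.AntiIdx),
    (∀ s, (e s).1 = s.1) ∧ (∀ t, (f t).1 = t.1) ∧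
    (∀ (s : T'.HoloIdx) (t : T'.AntiIdx),
      T'.pair (Sum.inl s) = Sum.inl t ↔ T.pair (Sum.inl (e s)) = Sum.inl (f t)) ∧
    (∀ s : T.HoloIdx, s ∉ Set.range e ↔
      ∃ t : T.AntiIdx, T.pair (Sum.inl s) = Sum.inl t ∧
        ((s.1 = u ∧ t.1 = v) ∨ (s.1 = v ∧ t.1 = u))) ∧
    (∀ t : T.AntiIdx, t ∉ Set.range f ↔
      ∃ s : T.HoloIdx, T.pair (Sum.inl s) = Sum.inl t ∧
        ((s.1 = u ∧ t.1 = v) ∨ (s.1 = v ∧ t.1 = u)))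

/-- The mixed fourth derivative `φ_{a c b̄ ē}` of a real function on `ℂⁿ`. -/
def phi4 (n : ℕ) (a c e₁ e₂ : Fin n) (φ : (Fin n → ℂ) → ℝ) : (Fin n → ℂ) → ℂ :=
  dz n a (dz n c (dzbar n e₁ (dzbar n e₂ (fun w => (φ w : ℂ)))))

/-- The `k`-Chern polynomial `I_{k_1,…,k_m}(φ) = (1/k!) contr(ch_{k_1,…,k_m}(φ))`
attached to the partition `k = k 0 + ⋯ + k (m-1)`.  Explicitly, writing the
total index set as `Σ j, Fin (k j)` and letting the cyclic rotation act within
each block, it equals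
`Σ_{a,b} Σ_{π} sgn(π) ∏_s φ_{a_s b_s ā_{rot s} b̄_{π s}}`. -/
def chernPoly (n m : ℕ) (k : Fin m → ℕ) (φ : (Fin n → ℂ) → ℝ)
    (z : Fin n → ℂ) : ℂ :=
  ∑ a : (Σ j : Fin m, Fin (k j)) → Fin n,
    ∑ b : (Σ j : Fin m, Fin (k j)) → Fin n,
      ∑ π : Equiv.Perm (Σ j : Fin m, Fin (k j)),
        ((Equiv.Perm.sign π : ℤ) : ℂ) *
          ∏ s : Σ j : Fin m, Fin (k j),
            phi4 n (a s) (b s) (a ⟨s.1, finRotate (k s.1) s.2⟩) (b (π s)) φ z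

/-- The term of maximum height `Δφ_{a_1 ā_2} Δφ_{a_2 ā_3} ⋯ Δφ_{a_k ā_1}`. -/
def maxHeightTerm (n k : ℕ) (φ : (Fin n → ℂ) → ℝ) (z : Fin n → ℂ) : ℂ :=
  ∑ a : Fin k → Fin n,
    ∏ i : Fin k, ∑ b : Fin n, phi4 n (a i) b (a (finRotate k i)) b φ z

section Wirtinger

open Filter Topology

variable {n : ℕ}

/-- The common form of the Wirtinger operators: `c = -I` gives `dz`, `c = I` gives `dzbar`. -/
def wirt (c : ℂ) (n : ℕ) (a : Fin n) (f : (Fin n → ℂ) → ℂ) : (Fin n → ℂ) → ℂ :=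
  fun z => (1 / 2 : ℂ) * (fderiv ℝ f z (Pi.single a 1) + c * fderiv ℝ f z (Pi.single a Complex.I))

theorem dz_eq_wirt (a : Fin n) (f : (Fin n → ℂ) → ℂ) : dz n a f = wirt (-Complex.I) n a f := by
  funext z
  simp only [dz, wirt]
  ring

theorem dzbar_eq_wirt (a : Fin n) (f : (Fin n → ℂ) → ℂ) : dzbar n a f = wirt Complex.I n a f :=
  rfl

/-- Iterated `wirt` along a list of directions. -/
def wirtList (c : ℂ) (l : List (Fin n)) (f : (Fin n → ℂ) → ℂ) : (Fin n → ℂ) → ℂ :=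
  l.foldr (fun a g => wirt c n a g) f

theorem mixedDeriv_eq_wirtList {A B : ℕ} (hs : Fin A → Fin n) (as : Fin B → Fin n)
    (f : (Fin n → ℂ) → ℂ) :
    mixedDeriv n hs as f =
      wirtList (-Complex.I) (List.ofFn hs) (wirtList Complex.I (List.ofFn as) f) := by
  simp only [mixedDeriv, wirtList, dz_eq_wirt, dzbar_eq_wirt]

theorem contDiff_wirt (c : ℂ) (a : Fin n) {f : (Fin n → ℂ) → ℂ}
    (hf : ContDiff ℝ (⊤ : ℕ∞) f) : ContDiff ℝ (⊤ : ℕ∞) (wirt c n a f) := by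
  have h : ContDiff ℝ (⊤ : ℕ∞) (fderiv ℝ f) := hf.fderiv_right (by simp)
  exact contDiff_const.mul
    ((h.clm_apply contDiff_const).add (contDiff_const.mul (h.clm_apply contDiff_const)))

theorem contDiff_wirtList (c : ℂ) (l : List (Fin n)) {f : (Fin n → ℂ) → ℂ}
    (hf : ContDiff ℝ (⊤ : ℕ∞) f) : ContDiff ℝ (⊤ : ℕ∞) (wirtList c l f) := by
  induction l with
  | nil => exact hf
  | cons a l ih => exact contDiff_wirt c a ih

theorem wirtList_congr (c : ℂ) (l : List (Fin n)) {f g : (Fin n → ℂ) → ℂ} {z : Fin n → ℂ}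
    (h : f =ᶠ[𝓝 z] g) : wirtList c l f =ᶠ[𝓝 z] wirtList c l g := by
  induction l with
  | nil => exact h
  | cons a l ih =>
    filter_upwards [ih.fderiv (𝕜 := ℝ)] with w hw
    simp only [wirtList, List.foldr_cons, wirt] at hw ⊢
    rw [hw]

theorem wirtList_add_mul (c : ℂ) (l : List (Fin n)) {f g : (Fin n → ℂ) → ℂ} (k : ℂ)
    (hf : ContDiff ℝ (⊤ : ℕ∞) f) (hg : ContDiff ℝ (⊤ : ℕ∞) g) :
    wirtList c l (fun w => f w + k * g w) = fun w => wirtList c l f w + k * wirtList c l g w := by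
  induction l with
  | nil => rfl
  | cons a l ih =>
    have h1 := (contDiff_wirtList c l hf).differentiable (by simp)
    have h2 := (contDiff_wirtList c l hg).differentiable (by simp)
    have h3 : wirtList c (a :: l) (fun w => f w + k * g w)
      = wirt c n a (wirtList c l (fun w => f w + k * g w)) := rfl
    rw [h3, ih]
    funext z
    change _ = wirt c n a (wirtList c l f) z + k * wirt c n a (wirtList c l g) z
    simp only [wirt]
    rw [fderiv_fun_add (h1 z) ((h2 z).const_mul k), fderiv_const_mul (h2 z)]
    simp only [add_apply, smul_apply, smul_eq_mul]
    ring

theorem mixedDeriv_congr {A B : ℕ} (hs : Fin A → Fin n) (as : Fin B → Fin n)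
    {f g : (Fin n → ℂ) → ℂ} {z : Fin n → ℂ} (h : f =ᶠ[𝓝 z] g) :
    mixedDeriv n hs as f z = mixedDeriv n hs as g z := by
  rw [mixedDeriv_eq_wirtList, mixedDeriv_eq_wirtList]
  exact (wirtList_congr _ _ (wirtList_congr _ _ h)).eq_of_nhds

theorem mixedDeriv_add_mul {A B : ℕ} (hs : Fin A → Fin n) (as : Fin B → Fin n)
    {f g : (Fin n → ℂ) → ℂ} (k : ℂ)
    (hf : ContDiff ℝ (⊤ : ℕ∞) f) (hg : ContDiff ℝ (⊤ : ℕ∞) g) (z : Fin n → ℂ) :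
    mixedDeriv n hs as (fun w => f w + k * g w) z
      = mixedDeriv n hs as f z + k * mixedDeriv n hs as g z := by
  simp only [mixedDeriv_eq_wirtList]
  rw [wirtList_add_mul _ _ k hf hg, wirtList_add_mul _ _ k (contDiff_wirtList _ _ hf)
    (contDiff_wirtList _ _ hg)]

/-- The real-linear form `z ↦ ∑ₐ (lₐ zₐ + mₐ z̄ₐ)`. -/
def linForm (l m : Fin n → ℂ) : (Fin n → ℂ) →L[ℝ] ℂ :=
  ∑ a, (l a • (ContinuousLinearMap.proj a : (Fin n → ℂ) →L[ℝ] ℂ) +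
    m a • (Complex.conjCLE.toContinuousLinearMap.comp
      (ContinuousLinearMap.proj a : (Fin n → ℂ) →L[ℝ] ℂ)))

theorem linForm_single (l m : Fin n → ℂ) (a : Fin n) (w : ℂ) :
    linForm l m (Pi.single a w) = l a * w + m a * (starRingEnd ℂ) w := by
  rw [linForm, sum_apply, Finset.sum_eq_single a]
  · simp
  · intro b _ hb
    simp [Pi.single_eq_of_ne hb]
  · simp

/-- The exponential of `linForm l m`. -/
def expForm (l m : Fin n → ℂ) (z : Fin n → ℂ) : ℂ := Complex.exp (linForm l m z)

theorem contDiff_expForm (l m : Fin n → ℂ) : ContDiff ℝ (⊤ : ℕ∞) (expForm l m) :=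
  (linForm l m).contDiff.cexp

theorem wirt_mul_expForm (c k : ℂ) (l m : Fin n → ℂ) (a : Fin n) :
    wirt c n a (fun z => k * expForm l m z) = fun z =>
      (k * ((1 / 2 : ℂ) * (linForm l m (Pi.single a 1) + c * linForm l m (Pi.single a Complex.I))))
        * expForm l m z := by
  funext z
  have h : HasFDerivAt (fun z => k * expForm l m z)
      (k • (Complex.exp (linForm l m z) • linForm l m)) z :=
    ((linForm l m).hasFDerivAt.cexp).const_mul k
  simp only [wirt, h.fderiv, smul_apply, smul_eq_mul]
  simp only [expForm]
  ring

theorem wirtList_mul_expForm (c k : ℂ) (l m d : Fin n → ℂ)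
    (hd : ∀ a, (1 / 2 : ℂ) * (linForm l m (Pi.single a 1) + c * linForm l m (Pi.single a Complex.I))
      = d a) (L : List (Fin n)) :
    wirtList c L (fun z => k * expForm l m z) = fun z => (k * (L.map d).prod) * expForm l m z := by
  induction L with
  | nil => simp [wirtList]
  | cons a L ih =>
    have h3 : wirtList c (a :: L) (fun z => k * expForm l m z)
      = wirt c n a (wirtList c L (fun z => k * expForm l m z)) := rfl
    rw [h3, ih, wirt_mul_expForm, hd]
    funext z
    simp only [List.map_cons, List.prod_cons]
    ring

theorem mixedDeriv_expForm_zero {A B : ℕ} (hs : Fin A → Fin n) (as : Fin B → Fin n)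
    (l m : Fin n → ℂ) :
    mixedDeriv n hs as (expForm l m) 0 = (∏ s, l (hs s)) * ∏ t, m (as t) := by
  have hI : Complex.I * Complex.I = -1 := Complex.I_mul_I
  have h := wirtList_mul_expForm Complex.I 1 l m m
    (fun a => by
      simp only [linForm_single, map_one, Complex.conj_I]
      linear_combination (1 / 2 : ℂ) * (l a - m a) * hI) (List.ofFn as)
  have h' := wirtList_mul_expForm (-Complex.I) (1 * ((List.ofFn as).map m).prod) l m l
    (fun a => by
      simp only [linForm_single, map_one, Complex.conj_I]
      linear_combination -(1 / 2 : ℂ) * (l a - m a) * hI) (List.ofFn hs)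
  simp only [one_mul] at h h'
  rw [mixedDeriv_eq_wirtList, h, h']
  simp [expForm, List.map_ofFn, List.prod_ofFn, mul_comm]

/-- Each exponential is, near the origin, of the form `f + i g` with `f`, `g` real-valued test
functions. -/
theorem exists_smoothCpt_mixedDeriv (l m : Fin n → ℂ) :
    ∃ φ : Bool → (Fin n → ℂ) → ℝ, (∀ b, SmoothCpt n (φ b)) ∧
      ∀ (A B : ℕ) (hs : Fin A → Fin n) (as : Fin B → Fin n),
        (∏ s, l (hs s)) * ∏ t, m (as t) =
          ∑ b : Bool, (if b then 1 else Complex.I) *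
            mixedDeriv n hs as (fun w => (φ b w : ℂ)) 0 := by
  let χ : ContDiffBump (0 : Fin n → ℂ) := default
  have hχ : ContDiff ℝ (⊤ : ℕ∞) χ := χ.contDiff
  have hE := contDiff_expForm l m
  have hre : ContDiff ℝ (⊤ : ℕ∞) fun w => χ w * (expForm l m w).re :=
    hχ.mul (Complex.reCLM.contDiff.comp hE)
  have him : ContDiff ℝ (⊤ : ℕ∞) fun w => χ w * (expForm l m w).im :=
    hχ.mul (Complex.imCLM.contDiff.comp hE)
  refine ⟨fun b w => χ w * (if b then (expForm l m w).re else (expForm l m w).im), ?_, ?_⟩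
  · rintro (_ | _)
    · exact ⟨by simpa using him, χ.hasCompactSupport.mul_right⟩
    · exact ⟨by simpa using hre, χ.hasCompactSupport.mul_right⟩
  · intro A B hs as
    have h1 := mixedDeriv_add_mul hs as Complex.I (Complex.ofRealCLM.contDiff.comp hre)
      (Complex.ofRealCLM.contDiff.comp him) 0
    rw [← mixedDeriv_expForm_zero]
    have h2 : expForm l m =ᶠ[𝓝 0] fun w =>
        (Complex.ofRealCLM ∘ fun w => χ w * (expForm l m w).re) w +
          Complex.I * (Complex.ofRealCLM ∘ fun w => χ w * (expForm l m w).im) w := by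
      filter_upwards [χ.eventuallyEq_one] with w hw
      rw [Function.comp_apply, Function.comp_apply]
      simp only [hw, Pi.one_apply, one_mul, Complex.ofRealCLM_apply]
      rw [mul_comm, Complex.re_add_im]
    rw [mixedDeriv_congr hs as h2, h1]
    simp [Function.comp_def]

end Wirtinger

namespace Term

variable {σ p q : ℕ}

open Classical in
/-- Evaluation of a formal contraction on an arbitrary family of jets. -/
def jetEval (n : ℕ) (T : Term σ p q)
    (D : Fin σ → ∀ A B : ℕ, (Fin A → Fin n) → (Fin B → Fin n) → ℂ)
    (fh : Fin p → Fin n) (fa : Fin q → Fin n) : ℂ :=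
  ∑ v : (T.HoloIdx ⊕ Fin q) → Fin n,
    (if (∀ i : Fin q, v (Sum.inr i) = fa i) ∧
        (∀ (s : T.HoloIdx) (i : Fin p),
          T.pair (Sum.inl s) = Sum.inr i → v (Sum.inl s) = fh i)
      then (1 : ℂ) else 0) *
    ∏ j : Fin σ, D j (T.A j) (T.B j) (fun s => v (Sum.inl ⟨j, s⟩))
        (fun t => v (T.pair.symm (Sum.inl ⟨j, t⟩)))

theorem jetEval_sum {n : ℕ} (T : Term σ p q) {ι : Type*} [Fintype ι] (c : ι → ℂ)
    (D : Fin σ → ι → ∀ A B : ℕ, (Fin A → Fin n) → (Fin B → Fin n) → ℂ)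
    (fh : Fin p → Fin n) (fa : Fin q → Fin n) :
    T.jetEval n (fun j A B hs as => ∑ b, c b * D j b A B hs as) fh fa =
      ∑ f : Fin σ → ι, (∏ j, c (f j)) * T.jetEval n (fun j => D j (f j)) fh fa := by
  classical
  simp only [jetEval, Finset.prod_univ_sum, Fintype.piFinset_univ, Finset.mul_sum]
  rw [Finset.sum_comm]
  refine Finset.sum_congr rfl fun f _ => Finset.sum_congr rfl fun v _ => ?_
  rw [Finset.prod_mul_distrib]
  ring

/-- The factor carrying the slot `y`, or its label if `y` is free. -/
abbrev left (T : Term σ p q) (y : T.HoloIdx ⊕ Fin q) : Fin σ ⊕ Fin q := Sum.map Sigma.fst id y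

/-- The factor carrying the partner of the slot `y`, or its label if this partner is free. -/
abbrev right (T : Term σ p q) (y : T.HoloIdx ⊕ Fin q) : Fin σ ⊕ Fin p :=
  Sum.map Sigma.fst id (T.pair y)

/-- The factor carrying the `i`-th free holomorphic index. -/
def freeHolo (T : Term σ p q) (i : Fin p) : Fin σ := ((T.pair.symm (Sum.inr i)).getLeft (T.okp i)).1

/-- The factor carrying the `i`-th free anti-holomorphic index. -/
def freeAnti (T : Term σ p q) (i : Fin q) : Fin σ := ((T.pair (Sum.inr i)).getLeft (T.okq i)).1

theorem left_symm_inr (T : Term σ p q) (i : Fin p) :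
    T.left (T.pair.symm (Sum.inr i)) = Sum.inl (T.freeHolo i) := by
  unfold freeHolo left
  generalize_proofs h
  revert h
  cases T.pair.symm (Sum.inr i) <;> simp

theorem right_inr (T : Term σ p q) (i : Fin q) :
    T.right (Sum.inr i) = Sum.inl (T.freeAnti i) := by
  unfold freeAnti right
  generalize_proofs h
  revert h
  cases T.pair (Sum.inr i) <;> simp

/-- The number of contracted pairs joining a given ordered pair of factors. -/
def pairCount (T : Term σ p q) : Fin σ × Fin σ →₀ ℕ :=
  ∑ s : T.HoloIdx, Sum.elim (fun j => Finsupp.single (s.1, j) 1) (fun _ => 0) (T.right (Sum.inl s))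

theorem pairCount_apply (T : Term σ p q) (i j : Fin σ) :
    T.pairCount (i, j) =
      ∑ s : T.HoloIdx, if s.1 = i ∧ T.right (Sum.inl s) = Sum.inl j then 1 else 0 := by
  rw [pairCount, Finsupp.finsetSum_apply]
  refine Finset.sum_congr rfl fun s _ => ?_
  cases T.right (Sum.inl s) <;> simp [Finsupp.single_apply]

theorem card_fiber (T : Term σ p q) (a : Fin σ ⊕ Fin q) (b : Fin σ ⊕ Fin p) :
    Fintype.card {y // (T.left y, T.right y) = (a, b)} =
      match a, b with
      | Sum.inl i, Sum.inl j => T.pairCount (i, j)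
      | Sum.inl i, Sum.inr k => if T.freeHolo k = i then 1 else 0
      | Sum.inr l, b => if Sum.inl (T.freeAnti l) = b then 1 else 0 := by
  rw [Fintype.card_subtype, Finset.card_filter]
  rcases a with i | l
  · rcases b with j | k
    · rw [Fintype.sum_sum_type]
      simp [pairCount_apply]
    · rw [Finset.sum_eq_single (T.pair.symm (Sum.inr k))]
      · rw [T.left_symm_inr]
        simp [right]
      · intro y _ hy
        rw [if_neg]
        intro h
        apply hy
        rw [Equiv.eq_symm_apply]
        have h2 := congrArg Prod.snd h
        simp only [right] at h2
        cases hy' : T.pair y <;> simp_all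
      · simp
  · rw [Finset.sum_eq_single (Sum.inr l)]
    · rw [T.right_inr]
      simp
    · rintro (s | m) _ hy
      · simp
      · rw [if_neg]
        intro h
        apply hy
        have h2 := congrArg Prod.fst h
        simpa using h2
    · simp

end Term

/-- A label-preserving bijection of sums restricts to the first summands. -/
theorem exists_equiv_sum_map {ι κ : Type*} {H H' : Type*} (π : H → ι) (π' : H' → ι)
    (g : (H ⊕ κ) ≃ (H' ⊕ κ)) (hg : ∀ y, Sum.map π' id (g y) = Sum.map π id y) :
    ∃ e : H ≃ H', (∀ s, π' (e s) = π s) ∧ ∀ y, g y = Sum.map e id y := by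
  have hinl : ∀ s, ∃ s', g (Sum.inl s) = Sum.inl s' := by
    intro s
    have := hg (Sum.inl s)
    cases h : g (Sum.inl s) <;> simp_all
  have hinr : ∀ k, g (Sum.inr k) = Sum.inr k := by
    intro k
    have := hg (Sum.inr k)
    cases h : g (Sum.inr k) <;> simp_all
  choose e he using hinl
  have hinj : Function.Injective e := by
    intro s t hst
    apply Sum.inl_injective (β := κ)
    apply g.injective
    rw [he, he, hst]
  have hsurj : Function.Surjective e := by
    intro s'
    obtain ⟨y, hy⟩ := g.surjective (Sum.inl s')
    rcases y with s | k
    · refine ⟨s, ?_⟩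
      rw [he] at hy
      exact Sum.inl_injective hy
    · rw [hinr] at hy
      simp at hy
  refine ⟨Equiv.ofBijective e ⟨hinj, hsurj⟩, ?_, ?_⟩
  · intro s
    have := hg (Sum.inl s)
    rw [he] at this
    exact Sum.inl_injective this
  · rintro (s | k)
    · exact he s
    · exact hinr k

theorem formallyEq_iff {σ p q : ℕ} (T T' : Term σ p q) :
    FormallyEq T T' ↔
      T.freeHolo = T'.freeHolo ∧ T.freeAnti = T'.freeAnti ∧ T.pairCount = T'.pairCount := by
  constructor
  · rintro ⟨e, f, he, hf, h⟩
    have hleft : ∀ y, T'.left (Sum.map e id y) = T.left y := by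
      rintro (s | l) <;> simp [he]
    have hright : ∀ y, T'.right (Sum.map e id y) = T.right y := by
      intro y
      rw [Term.right, h]
      cases hy : T.pair y <;> simp [Term.right, hf, hy]
    refine ⟨?_, ?_, ?_⟩
    · funext k
      apply Sum.inl_injective (β := Fin q)
      rw [← T.left_symm_inr, ← T'.left_symm_inr, ← hleft]
      congr 1
      rw [Equiv.eq_symm_apply, h]
      simp
    · funext l
      apply Sum.inl_injective (β := Fin p)
      rw [← T.right_inr, ← T'.right_inr, ← hright]
      rfl
    · rw [Term.pairCount, Term.pairCount, ← Equiv.sum_comp e]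
      refine Finset.sum_congr rfl fun s _ => ?_
      rw [← hright, he]
      rfl
  · rintro ⟨h1, h2, h3⟩
    have hcard : ∀ c : (Fin σ ⊕ Fin q) × (Fin σ ⊕ Fin p),
        Nonempty ({y // (T.left y, T.right y) = c} ≃ {y // (T'.left y, T'.right y) = c}) := by
      rintro ⟨a, b⟩
      refine ⟨Fintype.equivOfCardEq ?_⟩
      rw [T.card_fiber, T'.card_fiber, h1, h2, h3]
    let g := Equiv.ofFiberEquiv (f := fun y => (T.left y, T.right y))
      (g := fun y => (T'.left y, T'.right y)) fun c => (hcard c).some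
    have hg : ∀ y, (T'.left (g y), T'.right (g y)) = (T.left y, T.right y) :=
      fun y => Equiv.ofFiberEquiv_map (fun c => (hcard c).some) y
    obtain ⟨e, he, hge⟩ := exists_equiv_sum_map Sigma.fst Sigma.fst g
      fun y => congrArg Prod.fst (hg y)
    obtain ⟨f, hf, hgf⟩ := exists_equiv_sum_map Sigma.fst Sigma.fst
      ((T.pair.symm.trans g).trans T'.pair) fun y => by
        have := congrArg Prod.snd (hg (T.pair.symm y))
        simpa [Term.right] using this
    refine ⟨e, f, he, hf, fun x => ?_⟩
    have := hgf (T.pair x)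
    simp only [Equiv.trans_apply, Equiv.symm_apply_apply] at this
    rw [hge] at this
    exact this

namespace Term

variable {σ p q : ℕ}

/-- The factorization of a product over anti-holomorphic slots into contracted and free slots. -/
theorem prod_antiIdx (T : Term σ p q) (x : Fin σ → Fin σ → ℂ) (b : Fin q → Fin σ) :
    ∏ t : T.AntiIdx, x (Sum.elim id b (T.left (T.pair.symm (Sum.inl t)))) t.1 =
      MvPolynomial.eval (fun c => x c.1 c.2) (MvPolynomial.monomial T.pairCount 1) *
        ∏ l, x (b l) (T.freeAnti l) := by
  have h1 : ∏ t : T.AntiIdx, x (Sum.elim id b (T.left (T.pair.symm (Sum.inl t)))) t.1 =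
      ∏ y : T.AntiIdx ⊕ Fin p, Sum.elim
        (fun j => x (Sum.elim id b (T.left (T.pair.symm y))) j) (fun _ => 1)
          (Sum.map Sigma.fst id y : Fin σ ⊕ Fin p) := by
    rw [Fintype.prod_sum_type]
    simp
  rw [h1, ← Equiv.prod_comp T.pair, Fintype.prod_sum_type]
  congr 1
  · rw [pairCount, MvPolynomial.monomial_sum_one, map_prod]
    refine Finset.prod_congr rfl fun s _ => ?_
    change Sum.elim _ _ (T.right (Sum.inl s)) = _
    rw [Equiv.symm_apply_apply]
    cases T.right (Sum.inl s) <;> simp [MvPolynomial.eval_monomial]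
  · refine Finset.prod_congr rfl fun l _ => ?_
    change Sum.elim _ _ (T.right (Sum.inr l)) = _
    rw [T.right_inr, Equiv.symm_apply_apply]
    simp

/-- Evaluation of a contraction on the jets of exponentials whose holomorphic frequencies are
coordinate vectors. -/
theorem jetEval_single {n : ℕ} (ι : Fin σ ↪ Fin n) (T : Term σ p q) (x : Fin σ → Fin σ → ℂ)
    (μ : Fin σ → Fin n → ℂ) (hμ : ∀ i j, μ j (ι i) = x i j)
    (a : Fin p → Fin σ) (b : Fin q → Fin σ) :
    T.jetEval n (fun j _ _ hs as => (∏ s, (Pi.single (ι j) 1 : Fin n → ℂ) (hs s)) * ∏ t, μ j (as t))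
        (ι ∘ a) (ι ∘ b) =
      if T.freeHolo = a then
        MvPolynomial.eval (fun c => x c.1 c.2) (MvPolynomial.monomial T.pairCount 1) *
          ∏ l, x (b l) (T.freeAnti l)
      else 0 := by
  classical
  have hprod : ∀ v : (T.HoloIdx ⊕ Fin q) → Fin n,
      ∏ j : Fin σ, ((∏ s : Fin (T.A j), (Pi.single (ι j) 1 : Fin n → ℂ) (v (Sum.inl ⟨j, s⟩))) *
        ∏ t : Fin (T.B j), μ j (v (T.pair.symm (Sum.inl ⟨j, t⟩)))) =
      (∏ s : T.HoloIdx, (Pi.single (ι s.1) 1 : Fin n → ℂ) (v (Sum.inl s))) *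
        ∏ t : T.AntiIdx, μ t.1 (v (T.pair.symm (Sum.inl t))) := by
    intro v
    rw [Finset.prod_mul_distrib, Fintype.prod_sigma, Fintype.prod_sigma]
  simp only [jetEval, hprod]
  rw [Finset.sum_eq_single (fun y => ι (Sum.elim id b (T.left y)))]
  · have hiff : (∀ (s : T.HoloIdx) (i : Fin p), T.pair (Sum.inl s) = Sum.inr i →
        ι (Sum.elim id b (T.left (Sum.inl s))) = (ι ∘ a) i) ↔ T.freeHolo = a := by
      constructor
      · intro h
        funext i
        have h1 := T.left_symm_inr i
        obtain ⟨s, hs⟩ := Sum.isLeft_iff.1 (T.okp i)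
        have h2 := h s i (by rw [← hs, Equiv.apply_symm_apply])
        rw [← hs, h1] at h2
        exact ι.injective h2
      · rintro rfl s i hs
        rw [← Equiv.eq_symm_apply] at hs
        rw [hs, T.left_symm_inr]
        rfl
    simp only [hiff]
    have hone : ∏ s : T.HoloIdx, (Pi.single (ι s.1) 1 : Fin n → ℂ)
        (ι (Sum.elim id b (T.left (Sum.inl s)))) = 1 :=
      Finset.prod_eq_one fun s _ => by simp
    rw [hone]
    simp only [hμ, T.prod_antiIdx]
    simp
  · intro v _ hv
    by_cases h1 : ∀ i : Fin q, v (Sum.inr i) = (ι ∘ b) i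
    · obtain ⟨s, hs⟩ : ∃ s : T.HoloIdx, v (Sum.inl s) ≠ ι s.1 := by
        by_contra! hcon
        apply hv
        funext y
        rcases y with s | l
        · simp [hcon]
        · simp [h1]
      have : ∏ s : T.HoloIdx, (Pi.single (ι s.1) 1 : Fin n → ℂ) (v (Sum.inl s)) = 0 :=
        Finset.prod_eq_zero (Finset.mem_univ s) (by simp [hs])
      rw [this]
      simp
    · rw [if_neg fun h => h1 h.1, zero_mul]
  · simp

end Term

theorem sum_jetEval_eq_zero {σ p q n : ℕ} (L : LinComb σ p q)
    (hvanish : ∀ Ψ : Fin σ → (Fin n → ℂ) → ℝ, (∀ j, SmoothCpt n (Ψ j)) →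
      ∀ (fh : Fin p → Fin n) (fa : Fin q → Fin n) (z : Fin n → ℂ),
        L.eval n Ψ fh fa z = 0)
    (l m : Fin σ → Fin n → ℂ) (fh : Fin p → Fin n) (fa : Fin q → Fin n) :
    ∑ i, L.coeff i * (L.term i).jetEval n
      (fun j _ _ hs as => (∏ s, l j (hs s)) * ∏ t, m j (as t)) fh fa = 0 := by
  choose φ hφ hD using fun j => exists_smoothCpt_mixedDeriv (l j) (m j)
  simp only [hD]
  have h : ∀ f : Fin σ → Bool, ∑ i, L.coeff i * (L.term i).jetEval n
      (fun j _ _ hs as => mixedDeriv n hs as (fun w => (φ j (f j) w : ℂ)) 0) fh fa = 0 :=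
    fun f => hvanish (fun j => φ j (f j)) (fun j => hφ j (f j)) fh fa 0
  have hsum : ∀ i, (L.term i).jetEval n
      (fun j _ _ hs as => ∑ b : Bool, (if b then 1 else Complex.I) *
            mixedDeriv n hs as (fun w => (φ j b w : ℂ)) 0) fh fa =
      ∑ f : Fin σ → Bool, (∏ j, if f j then 1 else Complex.I) * (L.term i).jetEval n
        (fun j _ _ hs as => mixedDeriv n hs as (fun w => (φ j (f j) w : ℂ)) 0) fh fa :=
    fun i => (L.term i).jetEval_sum (fun b : Bool => if b then 1 else Complex.I)
      (fun j b _ _ hs as => mixedDeriv n hs as (fun w => (φ j b w : ℂ)) 0) fh fa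
  simp only [hsum, Finset.mul_sum]
  rw [Finset.sum_comm]
  refine Finset.sum_eq_zero fun f _ => ?_
  simp only [mul_left_comm (L.coeff _), ← Finset.mul_sum]
  rw [h f, mul_zero]

/-- The generating polynomial of the terms with prescribed free indices. -/
def freePoly {σ p q : ℕ} (L : LinComb σ p q) (a : Fin p → Fin σ) (b : Fin q → Fin σ) :
    MvPolynomial (Fin σ × Fin σ) ℂ :=
  ∑ i, if (L.term i).freeHolo = a ∧ (L.term i).freeAnti = b then
    MvPolynomial.monomial (L.term i).pairCount (L.coeff i) else 0

/-- The polynomial `freePoly` vanishes at every invertible matrix. -/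
theorem eval_freePoly_eq_zero {σ p q n : ℕ} (hn : σ ≤ n) (L : LinComb σ p q)
    (hvanish : ∀ Ψ : Fin σ → (Fin n → ℂ) → ℝ, (∀ j, SmoothCpt n (Ψ j)) →
      ∀ (fh : Fin p → Fin n) (fa : Fin q → Fin n) (z : Fin n → ℂ),
        L.eval n Ψ fh fa z = 0)
    (a : Fin p → Fin σ) (b : Fin q → Fin σ) (x : Matrix (Fin σ) (Fin σ) ℂ) (hx : x.det ≠ 0) :
    MvPolynomial.eval (fun c => x c.1 c.2) (freePoly L a b) = 0 := by
  classical
  let ι := Fin.castLEEmb hn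
  let μ : Fin σ → Fin n → ℂ := fun j => Function.extend ι (fun i => x i j) 0
  have hμ : ∀ i j, μ j (ι i) = x i j := fun i j => ι.injective.extend_apply _ _ _
  have key : ∀ b' : Fin q → Fin σ, ∑ i, L.coeff i * (if (L.term i).freeHolo = a then
        MvPolynomial.eval (fun c => x c.1 c.2) (MvPolynomial.monomial (L.term i).pairCount 1) *
          ∏ l, x (b' l) ((L.term i).freeAnti l) else 0) = 0 := by
    intro b'
    have := sum_jetEval_eq_zero L hvanish (fun j => Pi.single (ι j) 1) μ (ι ∘ a) (ι ∘ b')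
    simpa only [fun i => (L.term i).jetEval_single ι x μ hμ a b'] using this
  have hinv : ∀ d : Fin q → Fin σ, ∑ b' : Fin q → Fin σ,
      (∏ l, x⁻¹ (b l) (b' l)) * ∏ l, x (b' l) (d l) = if d = b then 1 else 0 := by
    intro d
    have h1 : ∏ l, ∑ k, x⁻¹ (b l) k * x k (d l) = if d = b then (1 : ℂ) else 0 := by
      simp only [← Matrix.mul_apply, Matrix.nonsing_inv_mul x (isUnit_iff_ne_zero.2 hx)]
      simp only [Matrix.one_apply, Finset.prod_ite_zero, Finset.prod_const_one]
      simp [funext_iff, eq_comm]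
    rw [← h1, Finset.prod_univ_sum, Fintype.piFinset_univ]
    simp only [Finset.prod_mul_distrib]
  have hzero : ∑ b' : Fin q → Fin σ, (∏ l, x⁻¹ (b l) (b' l)) *
      ∑ i, L.coeff i * (if (L.term i).freeHolo = a then
        MvPolynomial.eval (fun c => x c.1 c.2) (MvPolynomial.monomial (L.term i).pairCount 1) *
          ∏ l, x (b' l) ((L.term i).freeAnti l) else 0) = 0 :=
    Finset.sum_eq_zero fun b' _ => by rw [key, mul_zero]
  rw [← hzero, freePoly, map_sum]
  simp only [Finset.mul_sum]
  rw [Finset.sum_comm]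
  refine Finset.sum_congr rfl fun i _ => ?_
  by_cases ha : (L.term i).freeHolo = a
  · have hi := hinv (L.term i).freeAnti
    simp only [ha, true_and, if_true]
    trans (L.coeff i * MvPolynomial.eval (fun c => x c.1 c.2)
      (MvPolynomial.monomial (L.term i).pairCount 1)) *
        if (L.term i).freeAnti = b then 1 else 0
    · split_ifs <;> simp [MvPolynomial.eval_monomial]
    · rw [← hi, Finset.mul_sum]
      exact Finset.sum_congr rfl fun b' _ => by ring
  · simp [ha]

theorem freePoly_eq_zero {σ p q n : ℕ} (hn : σ ≤ n) (L : LinComb σ p q)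
    (hvanish : ∀ Ψ : Fin σ → (Fin n → ℂ) → ℝ, (∀ j, SmoothCpt n (Ψ j)) →
      ∀ (fh : Fin p → Fin n) (fa : Fin q → Fin n) (z : Fin n → ℂ),
        L.eval n Ψ fh fa z = 0)
    (a : Fin p → Fin σ) (b : Fin q → Fin σ) : freePoly L a b = 0 := by
  have hdet : (Matrix.mvPolynomialX (Fin σ) (Fin σ) ℂ).det ≠ 0 :=
    Matrix.det_mvPolynomialX_ne_zero (Fin σ) ℂ
  refine (mul_eq_zero.1 ?_).resolve_right hdet
  refine MvPolynomial.funext fun y => ?_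
  let x : Matrix (Fin σ) (Fin σ) ℂ := Matrix.of fun i j => y (i, j)
  have hy : MvPolynomial.eval y (Matrix.mvPolynomialX (Fin σ) (Fin σ) ℂ).det = x.det := by
    rw [RingHom.map_det]
    congr 1
    ext i j
    simp [x, Matrix.mvPolynomialX]
  rw [map_mul, hy, map_zero, mul_eq_zero]
  by_cases hx : x.det = 0
  · exact Or.inr hx
  · exact Or.inl (eval_freePoly_eq_zero hn L hvanish a b x hx)

/-- Second main theorem of invariant theory, Theorem 2.2:
if a multilinear combination of formal complete (or partial) contractions of
degree `σ` vanishes by substitution in some dimension `n ≥ σ`, then it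
vanishes formally. -/
theorem second_main_theorem {σ p q n : ℕ} (hσ : 0 < σ) (hn : σ ≤ n)
    (L : LinComb σ p q)
    (hvanish : ∀ Ψ : Fin σ → (Fin n → ℂ) → ℝ, (∀ j, SmoothCpt n (Ψ j)) →
      ∀ (fh : Fin p → Fin n) (fa : Fin q → Fin n) (z : Fin n → ℂ),
        L.eval n Ψ fh fa z = 0) :
    VanishesFormally L := by
  classical
  intro T₀
  have h := congrArg (MvPolynomial.coeff T₀.pairCount)
    (freePoly_eq_zero hn L hvanish T₀.freeHolo T₀.freeAnti)
  rw [freePoly, MvPolynomial.coeff_sum, MvPolynomial.coeff_zero] at h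
  refine Eq.trans ?_ h
  refine Finset.sum_congr rfl fun i _ => ?_
  rw [apply_ite (MvPolynomial.coeff T₀.pairCount), MvPolynomial.coeff_monomial,
    MvPolynomial.coeff_zero, ← ite_and]
  exact if_congr ((formallyEq_iff _ _).trans and_assoc.symm) rfl rfl

end KahlerInv
end
end

section
/- Let L(Ψ) be an invariant of Ψ of degree σ such that no term of L(Ψ) contains a trace, and assume there exists n ≥ σ − 1 such that L(Ψ) integrates to zero in dimension n. For each term, let N(l) denote the number of contractions between the factors ∂^{(A_1,B_1)}ψ^1 and ∂^{(A_σ,B_σ)}ψ^σ, and let M be the maximum of N(l) over all terms. Let L̃(Ψ) be the linear combination obtained from the terms of L(Ψ) with N(l) = M by erasing, in each such term, the M contracted index pairs joining the first and last factors. Then L̃(Ψ) also integrates to zero in dimension n. -/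
open MeasureTheory

noncomputable section

namespace KahlerInv

/-- The smooth complex-valued functions on `ℂⁿ`. -/
abbrev SmoothFun (n : ℕ) : Type := {f : (Fin n → ℂ) → ℂ // ContDiff ℝ (⊤ : ℕ∞) f}

/-- The first-order operator `(∂_v + c ∂_w) / 2`. -/
def pairDeriv {n : ℕ} (c : ℂ) (v w : Fin n → ℂ) (f : (Fin n → ℂ) → ℂ) : (Fin n → ℂ) → ℂ :=
  fun z => (1 / 2 : ℂ) * (fderiv ℝ f z v + c * fderiv ℝ f z w)

lemma contDiff_fderiv_apply {n : ℕ} {f : (Fin n → ℂ) → ℂ} (hf : ContDiff ℝ (⊤ : ℕ∞) f)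
    (v : Fin n → ℂ) : ContDiff ℝ (⊤ : ℕ∞) fun z => fderiv ℝ f z v :=
  (hf.fderiv_right (m := (⊤ : ℕ∞)) (by simp)).clm_apply contDiff_const

lemma contDiff_pairDeriv {n : ℕ} (c : ℂ) (v w : Fin n → ℂ) {f : (Fin n → ℂ) → ℂ}
    (hf : ContDiff ℝ (⊤ : ℕ∞) f) : ContDiff ℝ (⊤ : ℕ∞) (pairDeriv c v w f) :=
  contDiff_const.mul ((contDiff_fderiv_apply hf v).add
    (contDiff_const.mul (contDiff_fderiv_apply hf w)))

lemma fderiv_pairDeriv {n : ℕ} (c : ℂ) (v w u : Fin n → ℂ) {f : (Fin n → ℂ) → ℂ}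
    (hf : ContDiff ℝ (⊤ : ℕ∞) f) (z : Fin n → ℂ) :
    fderiv ℝ (pairDeriv c v w f) z u =
      (1 / 2 : ℂ) * (fderiv ℝ (fderiv ℝ f) z u v + c * fderiv ℝ (fderiv ℝ f) z u w) := by
  have hd : DifferentiableAt ℝ (fderiv ℝ f) z :=
    (hf.fderiv_right (m := (⊤ : ℕ∞)) (by simp)).differentiable (by simp) z
  have h (x : Fin n → ℂ) : HasFDerivAt (fun z => fderiv ℝ f z x)
      ((fderiv ℝ (fderiv ℝ f) z).flip x) z := by
    simpa using hd.hasFDerivAt.clm_apply (hasFDerivAt_const x z)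
  have := ((h v).add ((h w).const_mul c)).const_mul (1 / 2 : ℂ)
  change fderiv ℝ (fun z => (1 / 2 : ℂ) * (fderiv ℝ f z v + c * fderiv ℝ f z w)) z u = _
  rw [show fderiv ℝ (fun z => (1 / 2 : ℂ) * (fderiv ℝ f z v + c * fderiv ℝ f z w)) z = _ from
    this.fderiv]
  simp [mul_add]

lemma pairDeriv_comm {n : ℕ} (c d : ℂ) (v w x y : Fin n → ℂ) {f : (Fin n → ℂ) → ℂ}
    (hf : ContDiff ℝ (⊤ : ℕ∞) f) :
    pairDeriv c v w (pairDeriv d x y f) = pairDeriv d x y (pairDeriv c v w f) := by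
  funext z
  have hs : IsSymmSndFDerivAt ℝ f z := hf.contDiffAt.isSymmSndFDerivAt
    (by simpa using WithTop.coe_le_coe.2 (le_top (a := (2 : ℕ∞))))
  rw [pairDeriv, pairDeriv, fderiv_pairDeriv _ _ _ _ hf, fderiv_pairDeriv _ _ _ _ hf,
    fderiv_pairDeriv _ _ _ _ hf, fderiv_pairDeriv _ _ _ _ hf, hs.eq v x, hs.eq v y, hs.eq w x,
    hs.eq w y]
  ring

lemma pairDeriv_prod {n : ℕ} (c : ℂ) (v w : Fin n → ℂ) {ι : Type*} [Fintype ι] [DecidableEq ι]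
    {f : ι → (Fin n → ℂ) → ℂ} (hf : ∀ j, ContDiff ℝ (⊤ : ℕ∞) (f j)) (z : Fin n → ℂ) :
    pairDeriv c v w (fun z => ∏ j, f j z) z =
      ∑ j, (∏ k ∈ Finset.univ.erase j, f k z) * pairDeriv c v w (f j) z := by
  have h : HasFDerivAt (fun z => ∏ j, f j z)
      (∑ j, (∏ k ∈ Finset.univ.erase j, f k z) • fderiv ℝ (f j) z) z :=
    HasFDerivAt.finsetProd fun j _ => ((hf j).differentiable (by simp) z).hasFDerivAt
  simp only [pairDeriv, h.fderiv]
  simp only [sum_apply, smul_apply, smul_eq_mul,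
    Finset.mul_sum, ← Finset.sum_add_distrib]
  exact Finset.sum_congr rfl fun j _ => by ring

lemma hasCompactSupport_pairDeriv {n : ℕ} (c : ℂ) (v w : Fin n → ℂ) {f : (Fin n → ℂ) → ℂ}
    (hf : HasCompactSupport f) : HasCompactSupport (pairDeriv c v w f) :=
  HasCompactSupport.mul_left (f := fun _ => (1 / 2 : ℂ)) (HasCompactSupport.add
    (hf.fderiv_apply (𝕜 := ℝ) v)
    (HasCompactSupport.mul_left (f := fun _ => c) (hf.fderiv_apply (𝕜 := ℝ) w)))

lemma integral_pairDeriv {n : ℕ} (c : ℂ) (v w : Fin n → ℂ) {f : (Fin n → ℂ) → ℂ}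
    (hf : ContDiff ℝ (⊤ : ℕ∞) f) (hs : HasCompactSupport f) :
    ∫ z, pairDeriv c v w f z = 0 := by
  have hi (x : Fin n → ℂ) : Integrable fun z => fderiv ℝ f z x :=
    (contDiff_fderiv_apply hf x).continuous.integrable_of_hasCompactSupport
      (hs.fderiv_apply (𝕜 := ℝ) x)
  have h (x : Fin n → ℂ) : ∫ z, fderiv ℝ f z x = 0 := by
    have := integral_smul_fderiv_eq_neg_fderiv_smul_of_integrable (𝕜 := ℝ) (μ := volume)
      (f := fun _ : Fin n → ℂ => (1 : ℝ)) (g := f) (v := x) (by simp) (by simpa using hi x)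
      (by simpa using hf.continuous.integrable_of_hasCompactSupport hs)
      (fun _ _ => differentiableAt_const _) (fun x _ => hf.differentiable (by simp) x)
    simpa using this
  unfold pairDeriv
  rw [integral_const_mul, integral_add (hi v) ((hi w).const_mul c), integral_const_mul, h, h]
  simp

/-- The Wirtinger derivatives, indexed by `Sum.inl a` for `∂/∂z_a` and by `Sum.inr a` for
`∂/∂z̄_a`. -/
def wirtinger (n : ℕ) : Fin n ⊕ Fin n → ((Fin n → ℂ) → ℂ) → (Fin n → ℂ) → ℂ
  | .inl a => pairDeriv (-Complex.I) (Pi.single a 1) (Pi.single a Complex.I)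
  | .inr a => pairDeriv Complex.I (Pi.single a 1) (Pi.single a Complex.I)

lemma wirtinger_eq_pairDeriv {n : ℕ} (i : Fin n ⊕ Fin n) :
    ∃ c v w, wirtinger n i = pairDeriv c v w := by
  cases i <;> exact ⟨_, _, _, rfl⟩

lemma wirtinger_inl {n : ℕ} (a : Fin n) : wirtinger n (.inl a) = dz n a := by
  funext f z
  simp [wirtinger, pairDeriv, dz, sub_eq_add_neg]

/-- The Wirtinger derivatives as operators on smooth functions. -/
def SmoothFun.deriv {n : ℕ} (i : Fin n ⊕ Fin n) (f : SmoothFun n) : SmoothFun n :=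
  ⟨wirtinger n i f.1, by
    obtain ⟨c, v, w, h⟩ := wirtinger_eq_pairDeriv i
    rw [h]
    exact contDiff_pairDeriv c v w f.2⟩

instance {n : ℕ} : LeftCommutative (SmoothFun.deriv (n := n)) where
  left_comm i j f := by
    obtain ⟨c, v, w, hi⟩ := wirtinger_eq_pairDeriv i
    obtain ⟨d, x, y, hj⟩ := wirtinger_eq_pairDeriv j
    apply Subtype.ext
    simp only [SmoothFun.deriv, hi, hj]
    exact pairDeriv_comm c d v w x y f.2

/-- The iterated Wirtinger derivative along a multiset of indices. -/
def SmoothFun.iterDeriv {n : ℕ} (m : Multiset (Fin n ⊕ Fin n)) (f : SmoothFun n) : SmoothFun n :=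
  m.foldr SmoothFun.deriv f

lemma SmoothFun.iterDeriv_cons {n : ℕ} (i : Fin n ⊕ Fin n) (m : Multiset (Fin n ⊕ Fin n))
    (f : SmoothFun n) : f.iterDeriv (i ::ₘ m) = (f.iterDeriv m).deriv i :=
  Multiset.foldr_cons _ _ _ _

lemma SmoothFun.hasCompactSupport_iterDeriv {n : ℕ} (m : Multiset (Fin n ⊕ Fin n))
    {f : SmoothFun n} (hf : HasCompactSupport f.1) : HasCompactSupport (f.iterDeriv m).1 := by
  induction m using Multiset.induction with
  | empty => simpa [iterDeriv] using hf
  | cons i m ih =>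
    obtain ⟨c, v, w, h⟩ := wirtinger_eq_pairDeriv i
    rw [iterDeriv_cons]
    simpa only [deriv, h] using hasCompactSupport_pairDeriv c v w ih

lemma sum_singleton_eq_ofFn {α : Type*} {A : ℕ} (g : Fin A → α) :
    ∑ s, ({g s} : Multiset α) = (List.ofFn g : Multiset α) := by
  induction A with
  | zero => simp
  | succ A ih =>
    rw [Fin.sum_univ_succ, ih, List.ofFn_succ]
    rfl

lemma mixedDeriv_eq_iterDeriv {n A B : ℕ} (hs : Fin A → Fin n) (as : Fin B → Fin n)
    (f : SmoothFun n) :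
    mixedDeriv n hs as f.1 = (f.iterDeriv
      (∑ s, {Sum.inl (hs s)} + ∑ t, {Sum.inr (as t)})).1 := by
  have hr (l : List (Fin n)) : l.foldr (fun a g => dzbar n a g) f.1 =
      (f.iterDeriv (l.map Sum.inr : List (Fin n ⊕ Fin n))).1 := by
    induction l with
    | nil => rfl
    | cons a l ih =>
      rw [List.foldr_cons, ih, List.map_cons, ← Multiset.cons_coe, SmoothFun.iterDeriv_cons]
      rfl
  have hl (l l' : List (Fin n)) : l.foldr (fun a g => dz n a g)
      (l'.foldr (fun a g => dzbar n a g) f.1) =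
        (f.iterDeriv (l.map Sum.inl ++ l'.map Sum.inr : List (Fin n ⊕ Fin n))).1 := by
    induction l with
    | nil => exact hr l'
    | cons a l ih =>
      rw [List.foldr_cons, ih, List.map_cons, List.cons_append, ← Multiset.cons_coe,
        SmoothFun.iterDeriv_cons, ← wirtinger_inl]
      rfl
  rw [mixedDeriv, hl, sum_singleton_eq_ofFn, sum_singleton_eq_ofFn, List.map_ofFn, List.map_ofFn]
  rfl

/-- The Wirtinger indices carried by the factor `j` in the multi-index `m`. -/
def factorIndices {σ n : ℕ} (j : Fin σ) :
    (Fin σ × (Fin n ⊕ Fin n) →₀ ℕ) →+ Multiset (Fin n ⊕ Fin n) where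
  toFun m := ∑ i, Multiset.replicate (m (j, i)) i
  map_zero' := by simp
  map_add' m m' := by simp [Multiset.replicate_add, Finset.sum_add_distrib]

lemma factorIndices_single {σ n : ℕ} (j k : Fin σ) (i : Fin n ⊕ Fin n) :
    factorIndices j (Finsupp.single (k, i) 1) = if k = j then {i} else 0 := by
  simp only [factorIndices, AddMonoidHom.coe_mk, ZeroHom.coe_mk]
  split_ifs with h
  · subst h
    rw [Finset.sum_eq_single i]
    · simp
    · intro b _ hb
      simp [hb.symm]
    · simp
  · exact Finset.sum_eq_zero fun b _ => by simp [h]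

/-- The multidifferential operator with symbol `p`, the variable `(j, i)` standing for the
`i`-th Wirtinger derivative of the `j`-th function. -/
def symbolAct {σ n : ℕ} (Ψ : Fin σ → SmoothFun n) :
    MvPolynomial (Fin σ × (Fin n ⊕ Fin n)) ℂ →ₗ[ℂ] (Fin n → ℂ) → ℂ :=
  (MvPolynomial.basisMonomials _ ℂ).constr ℂ
    fun m z => ∏ j, ((Ψ j).iterDeriv (factorIndices j m)).1 z

lemma symbolAct_monomial {σ n : ℕ} (Ψ : Fin σ → SmoothFun n)
    (m : Fin σ × (Fin n ⊕ Fin n) →₀ ℕ) (c : ℂ) (z : Fin n → ℂ) :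
    symbolAct Ψ (MvPolynomial.monomial m c) z =
      c * ∏ j, ((Ψ j).iterDeriv (factorIndices j m)).1 z := by
  have h : MvPolynomial.monomial m c = c • MvPolynomial.basisMonomials _ ℂ m := by
    simp [MvPolynomial.smul_monomial]
  rw [h, map_smul, symbolAct, Module.Basis.constr_basis]
  rfl

lemma contDiff_symbolAct_monomial {σ n : ℕ} (Ψ : Fin σ → SmoothFun n)
    (m : Fin σ × (Fin n ⊕ Fin n) →₀ ℕ) :
    ContDiff ℝ (⊤ : ℕ∞) fun z => ∏ j, ((Ψ j).iterDeriv (factorIndices j m)).1 z :=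
  contDiff_prod fun j _ => ((Ψ j).iterDeriv _).2

lemma hasCompactSupport_symbolAct_monomial {σ n : ℕ} {Ψ : Fin σ → SmoothFun n} (u : Fin σ)
    (hΨ : HasCompactSupport (Ψ u).1) (m : Fin σ × (Fin n ⊕ Fin n) →₀ ℕ) :
    HasCompactSupport fun z => ∏ j, ((Ψ j).iterDeriv (factorIndices j m)).1 z := by
  have h := (SmoothFun.hasCompactSupport_iterDeriv (factorIndices u m) hΨ).mul_right
    (f' := fun z => ∏ j ∈ Finset.univ.erase u, ((Ψ j).iterDeriv (factorIndices j m)).1 z)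
  have he : (fun z => ∏ j, ((Ψ j).iterDeriv (factorIndices j m)).1 z) = _ := funext fun z =>
    (Finset.mul_prod_erase Finset.univ
      (fun j => ((Ψ j).iterDeriv (factorIndices j m)).1 z) (Finset.mem_univ u)).symm
  rw [he]
  exact h

lemma integrable_symbolAct {σ n : ℕ} {Ψ : Fin σ → SmoothFun n} (u : Fin σ)
    (hΨ : HasCompactSupport (Ψ u).1) (p : MvPolynomial (Fin σ × (Fin n ⊕ Fin n)) ℂ) :
    Integrable (symbolAct Ψ p) := by
  induction p using MvPolynomial.induction_on' with
  | monomial m c =>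
    have : symbolAct Ψ (MvPolynomial.monomial m c) = fun z => _ :=
      funext (symbolAct_monomial Ψ m c)
    rw [this]
    exact ((contDiff_symbolAct_monomial Ψ m).continuous.integrable_of_hasCompactSupport
      (hasCompactSupport_symbolAct_monomial u hΨ m)).const_mul c
  | add p q hp hq =>
    rw [map_add]
    exact hp.add hq

/-- The symbol of the total derivative `∂_i`. -/
def totalSymbol (σ n : ℕ) (i : Fin n ⊕ Fin n) : MvPolynomial (Fin σ × (Fin n ⊕ Fin n)) ℂ :=
  ∑ j, MvPolynomial.X (j, i)

lemma symbolAct_monomial_mul_totalSymbol {σ n : ℕ} (Ψ : Fin σ → SmoothFun n)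
    (m : Fin σ × (Fin n ⊕ Fin n) →₀ ℕ) (c : ℂ) (i : Fin n ⊕ Fin n) (z : Fin n → ℂ) :
    symbolAct Ψ (MvPolynomial.monomial m c * totalSymbol σ n i) z =
      c * wirtinger n i (fun z => ∏ j, ((Ψ j).iterDeriv (factorIndices j m)).1 z) z := by
  obtain ⟨d, v, w, h⟩ := wirtinger_eq_pairDeriv i
  rw [h, pairDeriv_prod d v w (fun j => ((Ψ j).iterDeriv _).2), totalSymbol, Finset.mul_sum,
    map_sum, Finset.sum_apply, Finset.mul_sum]
  refine Finset.sum_congr rfl fun j _ => ?_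
  rw [MvPolynomial.X, MvPolynomial.monomial_mul, mul_one, symbolAct_monomial,
    ← Finset.prod_erase_mul _ _ (Finset.mem_univ j)]
  congr 2
  · refine Finset.prod_congr rfl fun k hk => ?_
    rw [map_add, factorIndices_single, if_neg (Finset.ne_of_mem_erase hk).symm, add_zero]
  · rw [map_add, factorIndices_single, if_pos rfl, add_comm, Multiset.singleton_add,
      SmoothFun.iterDeriv_cons, ← h]
    rfl

lemma integral_symbolAct_mul_totalSymbol {σ n : ℕ} {Ψ : Fin σ → SmoothFun n} (u : Fin σ)
    (hΨ : HasCompactSupport (Ψ u).1) (p : MvPolynomial (Fin σ × (Fin n ⊕ Fin n)) ℂ)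
    (i : Fin n ⊕ Fin n) : ∫ z, symbolAct Ψ (p * totalSymbol σ n i) z = 0 := by
  induction p using MvPolynomial.induction_on' with
  | monomial m c =>
    obtain ⟨d, v, w, h⟩ := wirtinger_eq_pairDeriv i
    simp only [symbolAct_monomial_mul_totalSymbol, h]
    rw [integral_const_mul, integral_pairDeriv d v w (contDiff_symbolAct_monomial Ψ m)
      (hasCompactSupport_symbolAct_monomial u hΨ m), mul_zero]
  | add p q hp hq =>
    simp only [add_mul, map_add, Pi.add_apply]
    rw [integral_add (integrable_symbolAct u hΨ _) (integrable_symbolAct u hΨ _), hp, hq, add_zero]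

/-- The substitution eliminating the variables of the factor `u` on the locus where all total
symbols vanish. -/
def elimFactor {σ : ℕ} (n : ℕ) (u : Fin σ) (x : Fin σ × (Fin n ⊕ Fin n)) :
    MvPolynomial (Fin σ × (Fin n ⊕ Fin n)) ℂ :=
  if x.1 = u then -∑ k ∈ Finset.univ.erase u, MvPolynomial.X (k, x.2) else MvPolynomial.X x

lemma sub_bind₁_elimFactor_mem {σ n : ℕ} (u : Fin σ)
    (p : MvPolynomial (Fin σ × (Fin n ⊕ Fin n)) ℂ) :
    p - MvPolynomial.bind₁ (elimFactor n u) p ∈ Ideal.span (Set.range (totalSymbol σ n)) := by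
  set I := Ideal.span (Set.range (totalSymbol σ n))
  rw [← Ideal.Quotient.mk_eq_mk_iff_sub_mem]
  have : (Ideal.Quotient.mkₐ ℂ I) =
      (Ideal.Quotient.mkₐ ℂ I).comp (MvPolynomial.bind₁ (elimFactor n u)) := by
    refine MvPolynomial.algHom_ext fun x => ?_
    simp only [AlgHom.comp_apply, MvPolynomial.bind₁_X_right, elimFactor]
    split_ifs with h
    · simp only [Ideal.Quotient.mkₐ_eq_mk]
      rw [Ideal.Quotient.mk_eq_mk_iff_sub_mem, sub_neg_eq_add]
      obtain ⟨k, i⟩ := x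
      subst h
      rw [Finset.add_sum_erase _ (fun k => MvPolynomial.X (k, i)) (Finset.mem_univ _)]
      exact Ideal.subset_span ⟨i, rfl⟩
    · rfl
  exact DFunLike.congr_fun this p

lemma integral_symbolAct_bind₁_elimFactor {σ n : ℕ} {Ψ : Fin σ → SmoothFun n} (u : Fin σ)
    (hΨ : HasCompactSupport (Ψ u).1) (p : MvPolynomial (Fin σ × (Fin n ⊕ Fin n)) ℂ) :
    ∫ z, symbolAct Ψ (MvPolynomial.bind₁ (elimFactor n u) p) z = ∫ z, symbolAct Ψ p z := by
  have key : ∀ q ∈ Ideal.span (Set.range (totalSymbol σ n)), ∀ r,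
      ∫ z, symbolAct Ψ (r * q) z = 0 := by
    intro q hq
    induction hq using Submodule.span_induction with
    | mem q hq =>
      obtain ⟨i, rfl⟩ := hq
      exact fun r => integral_symbolAct_mul_totalSymbol u hΨ r i
    | zero => simp
    | add q q' _ _ hq hq' =>
      intro r
      simp only [mul_add, map_add, Pi.add_apply]
      rw [integral_add (integrable_symbolAct u hΨ _) (integrable_symbolAct u hΨ _), hq, hq',
        add_zero]
    | smul a q _ hq =>
      intro r
      rw [smul_eq_mul, ← mul_assoc]
      exact hq _
  have h := key _ (sub_bind₁_elimFactor_mem u p) 1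
  simp only [one_mul, map_sub, Pi.sub_apply] at h
  rw [integral_sub (integrable_symbolAct u hΨ _) (integrable_symbolAct u hΨ _)] at h
  exact (sub_eq_zero.1 h).symm

/-- The symbol of a complete contraction. -/
def Term.symbol {σ : ℕ} (n : ℕ) (T : Term σ 0 0) : MvPolynomial (Fin σ × (Fin n ⊕ Fin n)) ℂ :=
  ∑ v : (T.HoloIdx ⊕ Fin 0) → Fin n, ∏ j,
    ((∏ s : Fin (T.A j), MvPolynomial.X (j, Sum.inl (v (Sum.inl ⟨j, s⟩)))) *
      ∏ t : Fin (T.B j), MvPolynomial.X (j, Sum.inr (v (T.pair.symm (Sum.inl ⟨j, t⟩)))))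

/-- The symbol of a linear combination of complete contractions. -/
def LinComb.symbol {σ : ℕ} (n : ℕ) (L : LinComb σ 0 0) :
    MvPolynomial (Fin σ × (Fin n ⊕ Fin n)) ℂ :=
  ∑ r, L.coeff r • (L.term r).symbol n

/-- A real smooth function as a complex-valued one. -/
def SmoothFun.ofReal {n : ℕ} {ψ : (Fin n → ℂ) → ℝ} (h : ContDiff ℝ (⊤ : ℕ∞) ψ) : SmoothFun n :=
  ⟨fun w => (ψ w : ℂ), Complex.ofRealCLM.contDiff.comp h⟩

lemma SmoothFun.hasCompactSupport_ofReal {n : ℕ} {ψ : (Fin n → ℂ) → ℝ} (h : SmoothCpt n ψ) :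
    HasCompactSupport (SmoothFun.ofReal h.1).1 :=
  HasCompactSupport.comp_left (g := Complex.ofReal) h.2 Complex.ofReal_zero

lemma Term.eval_eq_symbolAct {σ n : ℕ} (T : Term σ 0 0) {Ψ : Fin σ → (Fin n → ℂ) → ℝ}
    (h : ∀ j, ContDiff ℝ (⊤ : ℕ∞) (Ψ j)) (z : Fin n → ℂ) :
    T.eval n Ψ noFree noFree z = symbolAct (fun j => SmoothFun.ofReal (h j)) (T.symbol n) z := by
  rw [Term.eval, Term.symbol, map_sum, Finset.sum_apply]
  refine Finset.sum_congr rfl fun v _ => ?_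
  rw [if_pos ⟨fun i => i.elim0, fun _ i => i.elim0⟩, one_mul]
  simp only [MvPolynomial.X, ← MvPolynomial.monomial_sum_one, MvPolynomial.monomial_mul, mul_one]
  rw [symbolAct_monomial, one_mul]
  refine Finset.prod_congr rfl fun j _ => ?_
  rw [map_sum, Finset.sum_eq_single j]
  · simp only [map_add, map_sum, factorIndices_single, if_true]
    rw [← mixedDeriv_eq_iterDeriv]
    rfl
  · intro k _ hk
    simp [factorIndices_single, hk]
  · simp

lemma LinComb.eval_eq_symbolAct {σ n : ℕ} (L : LinComb σ 0 0) {Ψ : Fin σ → (Fin n → ℂ) → ℝ}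
    (h : ∀ j, ContDiff ℝ (⊤ : ℕ∞) (Ψ j)) (z : Fin n → ℂ) :
    L.eval n Ψ noFree noFree z = symbolAct (fun j => SmoothFun.ofReal (h j)) (L.symbol n) z := by
  simp [LinComb.eval, LinComb.symbol, Term.eval_eq_symbolAct _ h, Finset.sum_apply]

/-- The real linear form on `ℂⁿ` with `∂/∂z_a`-derivative `x_a - i y_a` and
`∂/∂z̄_a`-derivative `x_a + i y_a`. -/
def realForm {n : ℕ} (x y : Fin n → ℝ) : (Fin n → ℂ) →L[ℝ] ℝ :=
  ∑ a, ((2 * x a) • Complex.reCLM + (2 * y a) • Complex.imCLM).comp (ContinuousLinearMap.proj a)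

lemma realForm_single {n : ℕ} (x y : Fin n → ℝ) (a : Fin n) (c : ℂ) :
    realForm x y (Pi.single a c) = 2 * x a * c.re + 2 * y a * c.im := by
  simp only [realForm, sum_apply]
  rw [Finset.sum_eq_single a]
  · simp
  · intro b _ hb
    simp [hb]
  · simp

/-- The symbol values of `realForm`. -/
def realFormSymbol {n : ℕ} (x y : Fin n → ℝ) : Fin n ⊕ Fin n → ℂ
  | .inl a => x a - Complex.I * y a
  | .inr a => x a + Complex.I * y a

lemma wirtinger_const_mul_exp_realForm {n : ℕ} (x y : Fin n → ℝ) (c : ℂ) (i : Fin n ⊕ Fin n)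
    (z : Fin n → ℂ) :
    wirtinger n i (fun w => c * ((Real.exp (realForm x y w) : ℝ) : ℂ)) z =
      realFormSymbol x y i * (c * ((Real.exp (realForm x y z) : ℝ) : ℂ)) := by
  have h := (Complex.ofRealCLM.hasFDerivAt.comp z (realForm x y).hasFDerivAt.exp).const_mul c
  have h' : fderiv ℝ (fun w => c * ((Real.exp (realForm x y w) : ℝ) : ℂ)) z = _ := h.fderiv
  cases i <;> simp only [wirtinger, pairDeriv, h'] <;>
    simp [realForm_single, realFormSymbol] <;> ring

lemma wirtinger_congr {n : ℕ} {f g : (Fin n → ℂ) → ℂ} {z : Fin n → ℂ} (i : Fin n ⊕ Fin n)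
    (h : f =ᶠ[nhds z] g) : wirtinger n i f z = wirtinger n i g z := by
  cases i <;> simp [wirtinger, pairDeriv, h.fderiv_eq]

lemma iterDeriv_eq_of_eqOn_exp {n : ℕ} (x y : Fin n → ℝ) {f : SmoothFun n}
    {U : Set (Fin n → ℂ)} (hU : IsOpen U)
    (hf : ∀ z ∈ U, f.1 z = ((Real.exp (realForm x y z) : ℝ) : ℂ))
    (m : Multiset (Fin n ⊕ Fin n)) {z : Fin n → ℂ} (hz : z ∈ U) :
    (f.iterDeriv m).1 z =
      (m.map (realFormSymbol x y)).prod * ((Real.exp (realForm x y z) : ℝ) : ℂ) := by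
  induction m using Multiset.induction generalizing z with
  | empty => simpa [SmoothFun.iterDeriv] using hf z hz
  | cons i m ih =>
    rw [SmoothFun.iterDeriv_cons]
    change wirtinger n i _ z = _
    rw [wirtinger_congr i (Filter.eventually_of_mem (hU.mem_nhds hz) fun w hw => ih hw),
      wirtinger_const_mul_exp_realForm, Multiset.map_cons, Multiset.prod_cons, mul_assoc]

lemma factorIndices_map_prod {σ n : ℕ} (j : Fin σ) (m : Fin σ × (Fin n ⊕ Fin n) →₀ ℕ)
    (v : Fin n ⊕ Fin n → ℂ) : ((factorIndices j m).map v).prod = ∏ i, v i ^ m (j, i) := by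
  simp only [factorIndices, AddMonoidHom.coe_mk, ZeroHom.coe_mk]
  rw [← Multiset.coe_mapAddMonoidHom, map_sum, Multiset.prod_sum]
  simp

lemma elimFactor_vars {σ n : ℕ} (u : Fin σ) (p : MvPolynomial (Fin σ × (Fin n ⊕ Fin n)) ℂ)
    {m : Fin σ × (Fin n ⊕ Fin n) →₀ ℕ}
    (hm : m ∈ (MvPolynomial.bind₁ (elimFactor n u) p).support) (i : Fin n ⊕ Fin n) :
    m (u, i) = 0 := by
  set S : Set (Fin σ × (Fin n ⊕ Fin n)) := {x | x.1 ≠ u}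
  have hS : MvPolynomial.bind₁ (elimFactor n u) p ∈ MvPolynomial.supported ℂ S := by
    clear hm
    induction p using MvPolynomial.induction_on with
    | C a =>
      rw [MvPolynomial.bind₁_C_right]
      exact Subalgebra.algebraMap_mem _ a
    | add p q hp hq =>
      rw [map_add]
      exact add_mem hp hq
    | mul_X p x hp =>
      rw [map_mul, MvPolynomial.bind₁_X_right, elimFactor]
      refine mul_mem hp ?_
      split_ifs with h
      · exact neg_mem (sum_mem fun k hk =>
          MvPolynomial.X_mem_supported.2 (Finset.ne_of_mem_erase hk))
      · exact MvPolynomial.X_mem_supported.2 h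
  by_contra h
  have := (MvPolynomial.mem_supported.1 hS) (
    (MvPolynomial.mem_vars_iff_mem_support _).2 ⟨m, hm, by simpa using h⟩)
  exact this rfl

/-- Real exponentials near the unit ball, together with a bump function in the slot `u`. -/
lemma exists_test_functions {σ n : ℕ} (u : Fin σ) (x y : Fin σ → Fin n → ℝ) :
    ∃ Ψ : Fin σ → (Fin n → ℂ) → ℝ, (∀ j, SmoothCpt n (Ψ j)) ∧ (∀ z, 0 ≤ Ψ u z) ∧ Ψ u 0 ≠ 0 ∧
      ∃ U : Set (Fin n → ℂ), IsOpen U ∧ (∀ z ∉ U, Ψ u z = 0) ∧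
        ∀ j ≠ u, ∀ z ∈ U, Ψ j z = Real.exp (realForm (x j) (y j) z) := by
  let η : ContDiffBump (0 : Fin n → ℂ) := ⟨1, 2, by norm_num, by norm_num⟩
  let χ : ContDiffBump (0 : Fin n → ℂ) := ⟨2, 3, by norm_num, by norm_num⟩
  refine ⟨fun j => if j = u then η else fun z => χ z * Real.exp (realForm (x j) (y j) z),
    fun j => ?_, fun z => ?_, ?_, Metric.ball 0 2, Metric.isOpen_ball, fun z hz => ?_,
    fun j hj z hz => ?_⟩
  · dsimp only
    split_ifs
    · exact ⟨η.contDiff, η.hasCompactSupport⟩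
    · exact ⟨χ.contDiff.mul (Real.contDiff_exp.comp (realForm _ _).contDiff),
        χ.hasCompactSupport.mul_right⟩
  · simpa using η.nonneg
  · have : η 0 = 1 := η.one_of_mem_closedBall (by simp [η])
    simp [this]
  · simpa using η.zero_of_le_dist (by simpa using hz)
  · simp [hj, χ.one_of_mem_closedBall (Metric.ball_subset_closedBall hz)]

lemma prod_iterDeriv_of_eqOn_exp {σ n : ℕ} (u : Fin σ) (x y : Fin σ → Fin n → ℝ)
    {Ψ : Fin σ → SmoothFun n} {U : Set (Fin n → ℂ)} (hU : IsOpen U)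
    (hzero : ∀ z ∉ U, (Ψ u).1 z = 0)
    (hexp : ∀ j ≠ u, ∀ z ∈ U, (Ψ j).1 z = ((Real.exp (realForm (x j) (y j) z) : ℝ) : ℂ))
    {m : Fin σ × (Fin n ⊕ Fin n) →₀ ℕ} (hm : ∀ i, m (u, i) = 0) (z : Fin n → ℂ) :
    ∏ j, ((Ψ j).iterDeriv (factorIndices j m)).1 z =
      ((Ψ u).1 z * ∏ j ∈ Finset.univ.erase u, ((Real.exp (realForm (x j) (y j) z) : ℝ) : ℂ)) *
        ∏ k, realFormSymbol (x k.1) (y k.1) k.2 ^ m k := by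
  have hu : factorIndices u m = 0 := by simp [factorIndices, hm]
  have hv : ∏ k, realFormSymbol (x k.1) (y k.1) k.2 ^ m k =
      ∏ j ∈ Finset.univ.erase u, ∏ i, realFormSymbol (x j) (y j) i ^ m (j, i) := by
    rw [Fintype.prod_prod_type, ← Finset.mul_prod_erase _ _ (Finset.mem_univ u)]
    simp [hm]
  have h0 : ((Ψ u).iterDeriv (factorIndices u m)).1 z = (Ψ u).1 z := by
    rw [hu]
    rfl
  rw [← Finset.mul_prod_erase _ _ (Finset.mem_univ u), h0, hv]
  by_cases hz : z ∈ U
  · rw [mul_assoc, ← Finset.prod_mul_distrib]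
    congr 1
    refine Finset.prod_congr rfl fun j hj => ?_
    rw [iterDeriv_eq_of_eqOn_exp (x j) (y j) hU (hexp j (Finset.ne_of_mem_erase hj)) _ hz,
      factorIndices_map_prod, mul_comm]
  · simp [hzero z hz]

lemma symbolAct_of_eqOn_exp {σ n : ℕ} (u : Fin σ) (x y : Fin σ → Fin n → ℝ)
    {Ψ : Fin σ → SmoothFun n} {U : Set (Fin n → ℂ)} (hU : IsOpen U)
    (hzero : ∀ z ∉ U, (Ψ u).1 z = 0)
    (hexp : ∀ j ≠ u, ∀ z ∈ U, (Ψ j).1 z = ((Real.exp (realForm (x j) (y j) z) : ℝ) : ℂ))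
    {q : MvPolynomial (Fin σ × (Fin n ⊕ Fin n)) ℂ} (hq : ∀ m ∈ q.support, ∀ i, m (u, i) = 0)
    (z : Fin n → ℂ) :
    symbolAct Ψ q z =
      ((Ψ u).1 z * ∏ j ∈ Finset.univ.erase u, ((Real.exp (realForm (x j) (y j) z) : ℝ) : ℂ)) *
        MvPolynomial.eval (fun k => realFormSymbol (x k.1) (y k.1) k.2) q := by
  conv_lhs => rw [q.as_sum]
  rw [map_sum, Finset.sum_apply, MvPolynomial.eval_eq', Finset.mul_sum]
  refine Finset.sum_congr rfl fun m hm => ?_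
  rw [symbolAct_monomial, prod_iterDeriv_of_eqOn_exp u x y hU hzero hexp (hq m hm)]
  ring

/-- If the operator with symbol `p` always integrates to zero, then eliminating a factor from `p`
gives a polynomial vanishing at the symbols of real linear forms. -/
lemma eval_bind₁_elimFactor_real {σ n : ℕ} (u : Fin σ)
    (p : MvPolynomial (Fin σ × (Fin n ⊕ Fin n)) ℂ)
    (hp : ∀ (Ψ : Fin σ → (Fin n → ℂ) → ℝ) (h : ∀ j, SmoothCpt n (Ψ j)),
      ∫ z, symbolAct (fun j => SmoothFun.ofReal (h j).1) p z = 0)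
    (x y : Fin σ → Fin n → ℝ) :
    MvPolynomial.eval (fun k => realFormSymbol (x k.1) (y k.1) k.2)
      (MvPolynomial.bind₁ (elimFactor n u) p) = 0 := by
  obtain ⟨Ψ, hΨ, hnn, h0, U, hU, hzero, hexp⟩ := exists_test_functions u x y
  have hact := symbolAct_of_eqOn_exp u x y (Ψ := fun j => SmoothFun.ofReal (hΨ j).1) hU
    (fun z hz => congrArg Complex.ofReal (hzero z hz))
    (fun j hj z hz => congrArg Complex.ofReal (hexp j hj z hz)) (fun _ => elimFactor_vars u p)
  set F : (Fin n → ℂ) → ℝ := fun z =>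
    Ψ u z * ∏ j ∈ Finset.univ.erase u, Real.exp (realForm (x j) (y j) z)
  have hF (z : Fin n → ℂ) : (F z : ℂ) = (SmoothFun.ofReal (hΨ u).1).1 z *
      ∏ j ∈ Finset.univ.erase u, ((Real.exp (realForm (x j) (y j) z) : ℝ) : ℂ) := by
    rw [Complex.ofReal_mul, Complex.ofReal_prod]
    rfl
  have hint := (integral_symbolAct_bind₁_elimFactor (Ψ := fun j => SmoothFun.ofReal (hΨ j).1) u
    (SmoothFun.hasCompactSupport_ofReal (hΨ u)) p).trans (hp Ψ hΨ)
  simp only [hact, ← hF, integral_mul_const] at hint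
  refine (mul_eq_zero.1 hint).resolve_left ?_
  have hc : Continuous F := (hΨ u).1.continuous.mul (continuous_finsetProd _ fun j _ =>
    Real.continuous_exp.comp (realForm _ _).continuous)
  have hs : HasCompactSupport F := (hΨ u).2.mul_right
  have hpos : 0 < ∫ z, F z :=
    hc.integral_pos_of_hasCompactSupport_nonneg_nonzero (x := 0) hs
      (fun z => mul_nonneg (hnn z) (Finset.prod_nonneg fun _ _ => (Real.exp_pos _).le))
      (mul_ne_zero h0 (Finset.prod_ne_zero_iff.2 fun _ _ => (Real.exp_pos _).ne'))
  rw [integral_complex_ofReal]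
  exact_mod_cast hpos.ne'

/-- The linear change of variables from real and imaginary parts to Wirtinger symbols. -/
def complexify {σ n : ℕ} : Fin σ × (Fin n ⊕ Fin n) → MvPolynomial (Fin σ × (Fin n ⊕ Fin n)) ℂ
  | (j, .inl a) =>
      MvPolynomial.X (j, .inl a) - MvPolynomial.C Complex.I * MvPolynomial.X (j, .inr a)
  | (j, .inr a) =>
      MvPolynomial.X (j, .inl a) + MvPolynomial.C Complex.I * MvPolynomial.X (j, .inr a)

lemma eq_zero_of_eval_realFormSymbol {σ n : ℕ} {q : MvPolynomial (Fin σ × (Fin n ⊕ Fin n)) ℂ}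
    (h : ∀ x y : Fin σ → Fin n → ℝ,
      MvPolynomial.eval (fun k => realFormSymbol (x k.1) (y k.1) k.2) q = 0) : q = 0 := by
  have hz : MvPolynomial.bind₁ complexify q = 0 := by
    refine MvPolynomial.funext_set (fun _ => Set.range ((↑) : ℝ → ℂ))
      (fun _ => Set.infinite_range_of_injective Complex.ofReal_injective) fun w hw => ?_
    choose r hr using fun k => hw k (Set.mem_univ k)
    rw [map_zero, ← h (fun j a => r (j, .inl a)) (fun j a => r (j, .inr a))]
    simp only [MvPolynomial.eval, MvPolynomial.eval₂Hom_bind₁]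
    congr 2
    funext ⟨j, i⟩
    cases i <;> simp [complexify, realFormSymbol, hr]
  refine MvPolynomial.funext fun w => ?_
  have := congrArg (MvPolynomial.eval fun k : Fin σ × (Fin n ⊕ Fin n) =>
    Sum.elim (fun a => (w (k.1, .inl a) + w (k.1, .inr a)) / 2)
      (fun a => (w (k.1, .inr a) - w (k.1, .inl a)) / (2 * Complex.I)) k.2) hz
  rw [map_zero] at this ⊢
  rw [← this]
  simp only [MvPolynomial.eval, MvPolynomial.eval₂Hom_bind₁]
  congr 2
  funext ⟨j, i⟩
  cases i <;> simp [complexify] <;> field_simp <;> ring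

lemma eval_bind₁_elimFactor {σ n : ℕ} (u : Fin σ) (p : MvPolynomial (Fin σ × (Fin n ⊕ Fin n)) ℂ)
    (w : Fin σ × (Fin n ⊕ Fin n) → ℂ) :
    MvPolynomial.eval w (MvPolynomial.bind₁ (elimFactor n u) p) =
      MvPolynomial.eval (fun x => if x.1 = u then -∑ k ∈ Finset.univ.erase u, w (k, x.2) else w x)
        p := by
  simp only [MvPolynomial.eval, MvPolynomial.eval₂Hom_bind₁]
  congr 2
  funext x
  simp only [elimFactor]
  split_ifs <;> simp

/-- A complete contraction integrates to zero exactly when its symbol vanishes wherever all total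
symbols do. -/
lemma integratesToZero_iff {σ n : ℕ} (u : Fin σ) (L : LinComb σ 0 0) :
    IntegratesToZero n L ↔ ∀ w : Fin σ × (Fin n ⊕ Fin n) → ℂ, (∀ i, ∑ j, w (j, i) = 0) →
      MvPolynomial.eval w (L.symbol n) = 0 := by
  constructor
  · intro h w hw
    have hz := eq_zero_of_eval_realFormSymbol
      (eval_bind₁_elimFactor_real u (L.symbol n) fun Ψ hΨ => by
        simpa only [L.eval_eq_symbolAct fun j => (hΨ j).1] using h Ψ hΨ)
    have := eval_bind₁_elimFactor u (L.symbol n) w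
    rw [hz, map_zero] at this
    rw [this]
    congr 2
    funext ⟨j, i⟩
    split_ifs with hj
    · dsimp only at hj
      subst hj
      rw [eq_neg_iff_add_eq_zero, Finset.add_sum_erase _ (fun k => w (k, i)) (Finset.mem_univ _),
        hw]
    · rfl
  · intro h Ψ hΨ
    have hz : MvPolynomial.bind₁ (elimFactor n u) (L.symbol n) = 0 := by
      refine MvPolynomial.funext fun w => ?_
      rw [eval_bind₁_elimFactor, map_zero]
      refine h _ fun i => ?_
      rw [← Finset.add_sum_erase _ _ (Finset.mem_univ u), if_pos rfl, neg_add_eq_zero]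
      exact Finset.sum_congr rfl fun k hk => by rw [if_neg (Finset.ne_of_mem_erase hk)]
    simp only [L.eval_eq_symbolAct fun j => (hΨ j).1]
    rw [← integral_symbolAct_bind₁_elimFactor (Ψ := fun j => SmoothFun.ofReal (hΨ j).1) u
      (SmoothFun.hasCompactSupport_ofReal (hΨ u)), hz, map_zero]
    simp

/-- The matching of holomorphic with anti-holomorphic slots given by a complete contraction. -/
def Term.matching {σ : ℕ} (T : Term σ 0 0) : T.HoloIdx ≃ T.AntiIdx :=
  (Equiv.sumEmpty _ _).symm.trans (T.pair.trans (Equiv.sumEmpty _ _))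

lemma Term.pair_inl {σ : ℕ} (T : Term σ 0 0) (s : T.HoloIdx) :
    T.pair (Sum.inl s) = Sum.inl (T.matching s) := by
  have h : T.matching s = Equiv.sumEmpty _ _ (T.pair (Sum.inl s)) := rfl
  rw [h]
  exact ((Equiv.sumEmpty _ (Fin 0)).symm_apply_apply (T.pair (Sum.inl s))).symm

lemma Term.pair_inl_eq_iff {σ : ℕ} (T : Term σ 0 0) (s : T.HoloIdx) (t : T.AntiIdx) :
    T.pair (Sum.inl s) = Sum.inl t ↔ T.matching s = t := by
  rw [T.pair_inl, Sum.inl.injEq]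

lemma Term.pair_symm_inl {σ : ℕ} (T : Term σ 0 0) (t : T.AntiIdx) :
    T.pair.symm (Sum.inl t) = Sum.inl (T.matching.symm t) := by
  rw [Equiv.symm_apply_eq, T.pair_inl, Equiv.apply_symm_apply]

/-- The pairing of the holomorphic symbol of factor `j` with the anti-holomorphic symbol of
factor `k`. -/
def gram {σ n : ℕ} (w : Fin σ × (Fin n ⊕ Fin n) → ℂ) (j k : Fin σ) : ℂ :=
  ∑ a, w (j, .inl a) * w (k, .inr a)

lemma Term.eval_symbol {σ n : ℕ} (T : Term σ 0 0) (w : Fin σ × (Fin n ⊕ Fin n) → ℂ) :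
    MvPolynomial.eval w (T.symbol n) = ∏ s, gram w s.1 (T.matching s).1 := by
  simp only [gram]
  rw [Finset.prod_univ_sum, Fintype.piFinset_univ, Term.symbol, map_sum]
  refine Fintype.sum_equiv (Equiv.arrowCongr (Equiv.sumEmpty T.HoloIdx (Fin 0)) (Equiv.refl _))
    _ _ fun v => ?_
  have hv (s : T.HoloIdx) : Equiv.arrowCongr (Equiv.sumEmpty T.HoloIdx (Fin 0)) (Equiv.refl _) v s =
      v (Sum.inl s) := rfl
  simp only [hv, map_prod, map_mul, MvPolynomial.eval_X, T.pair_symm_inl, Finset.prod_mul_distrib]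
  rw [← T.matching.symm.prod_comp (fun s => w ((T.matching s).1, Sum.inr (v (Sum.inl s)))),
    Fintype.prod_sigma, Fintype.prod_sigma]
  simp

lemma LinComb.eval_symbol {σ n : ℕ} (L : LinComb σ 0 0) (w : Fin σ × (Fin n ⊕ Fin n) → ℂ) :
    MvPolynomial.eval w (L.symbol n) =
      ∑ r, L.coeff r * ∏ s, gram w s.1 ((L.term r).matching s).1 := by
  simp [LinComb.symbol, Term.eval_symbol]

lemma sum_gram_left {σ n : ℕ} {w : Fin σ × (Fin n ⊕ Fin n) → ℂ} (hw : ∀ i, ∑ j, w (j, i) = 0)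
    (k : Fin σ) : ∑ j, gram w j k = 0 := by
  simp only [gram]
  rw [Finset.sum_comm]
  simp [← Finset.sum_mul, hw]

lemma sum_gram_right {σ n : ℕ} {w : Fin σ × (Fin n ⊕ Fin n) → ℂ} (hw : ∀ i, ∑ j, w (j, i) = 0)
    (j : Fin σ) : ∑ k, gram w j k = 0 := by
  simp only [gram]
  rw [Finset.sum_comm]
  simp [← Finset.mul_sum, hw]

/-- In dimension at least `σ - 1`, every matrix with zero row and column sums is the pairing matrix
of symbols with zero total. -/
lemma exists_gram_eq {σ n : ℕ} (u : Fin σ) (hn : σ ≤ n + 1) (H : Fin σ → Fin σ → ℂ)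
    (hl : ∀ k, ∑ j, H j k = 0) (hr : ∀ j, ∑ k, H j k = 0) :
    ∃ w : Fin σ × (Fin n ⊕ Fin n) → ℂ, (∀ i, ∑ j, w (j, i) = 0) ∧ gram w = H := by
  obtain ⟨e⟩ : Nonempty ({k : Fin σ // k ≠ u} ↪ Fin n) := by
    rw [Function.Embedding.nonempty_iff_card_le]
    simp
    omega
  let α (j : Fin σ) (a : Fin n) : ℂ := ∑ k, if e k = a then H j k else 0
  let β (l : Fin σ) (a : Fin n) : ℂ :=
    ∑ k, if e k = a then (if l = k then 1 else 0) - (if l = u then 1 else 0) else 0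
  have hβ (l : Fin σ) (k) : β l (e k) = (if l = k then 1 else 0) - (if l = u then 1 else 0) := by
    simp [β, e.injective.eq_iff]
  refine ⟨fun x => Sum.elim (α x.1) (β x.1) x.2, ?_, ?_⟩
  · rintro (a | a)
    · simp only [Sum.elim_inl, α]
      rw [Finset.sum_comm]
      refine Finset.sum_eq_zero fun k _ => ?_
      split_ifs
      · exact hl k
      · simp
    · simp only [Sum.elim_inr, β]
      rw [Finset.sum_comm]
      refine Finset.sum_eq_zero fun k _ => ?_
      split_ifs <;> simp
  · funext j l
    have h1 : gram (fun x => Sum.elim (α x.1) (β x.1) x.2) j l =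
        ∑ k : {k // k ≠ u}, H j k * ((if l = k then 1 else 0) - (if l = u then 1 else 0)) := by
      simp only [gram, Sum.elim_inl, Sum.elim_inr, α, Finset.sum_mul]
      rw [Finset.sum_comm]
      refine Finset.sum_congr rfl fun k _ => ?_
      rw [Finset.sum_eq_single (e k)]
      · rw [if_pos rfl, hβ]
      · intro a _ ha
        rw [if_neg ha.symm, zero_mul]
      · simp
    rw [h1]
    by_cases hlu : l = u
    · subst hlu
      have h2 := hr j
      rw [← Finset.add_sum_erase _ _ (Finset.mem_univ l),
        Finset.sum_subtype (p := (· ≠ l)) _ (by simp), ← eq_neg_iff_add_eq_zero] at h2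
      rw [h2, ← Finset.sum_neg_distrib]
      refine Finset.sum_congr rfl fun k _ => ?_
      simp [k.2.symm]
    · rw [Finset.sum_eq_single ⟨l, hlu⟩]
      · simp [hlu]
      · rintro ⟨k, hk⟩ _ hkl
        have : l ≠ k := fun h => hkl (Subtype.ext h.symm)
        simp [hlu, this]
      · simp

/-- The pair at the holomorphic slot `s` joins the factors `u` and `v`. -/
def Term.IsLink {σ : ℕ} (T : Term σ 0 0) (u v : Fin σ) (s : T.HoloIdx) : Prop :=
  (s.1 = u ∧ (T.matching s).1 = v) ∨ (s.1 = v ∧ (T.matching s).1 = u)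

lemma Term.exists_pair_inl_iff_isLink {σ : ℕ} (T : Term σ 0 0) (u v : Fin σ) (s : T.HoloIdx) :
    (∃ t : T.AntiIdx, T.pair (Sum.inl s) = Sum.inl t ∧
      ((s.1 = u ∧ t.1 = v) ∨ (s.1 = v ∧ t.1 = u))) ↔ T.IsLink u v s := by
  simp only [T.pair_inl_eq_iff, exists_eq_left', Term.IsLink]

open Classical in
lemma Term.linkCount_eq_card {σ : ℕ} (T : Term σ 0 0) (u v : Fin σ) :
    T.linkCount u v = (Finset.univ.filter (T.IsLink u v)).card := by
  simp only [Term.linkCount, T.exists_pair_inl_iff_isLink]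

open Classical in
lemma ErasesLinks.prod_eq {σ : ℕ} {u v : Fin σ} {T T' : Term σ 0 0} (h : ErasesLinks u v T T')
    (H : Fin σ → Fin σ → ℂ) :
    ∏ s, H s.1 (T'.matching s).1 =
      ∏ s ∈ Finset.univ.filter (fun s => ¬ T.IsLink u v s), H s.1 (T.matching s).1 := by
  obtain ⟨e, f, he, hf, hp, hre, -⟩ := h
  have hS : Finset.univ.filter (fun s => ¬ T.IsLink u v s) = Finset.univ.map e := by
    ext s
    rw [Finset.mem_filter_univ, ← T.exists_pair_inl_iff_isLink, ← hre, not_not]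
    simp
  rw [hS, Finset.prod_map]
  refine Finset.prod_congr rfl fun s _ => ?_
  have h1 : T.matching (e s) = f (T'.matching s) :=
    (T.pair_inl_eq_iff _ _).1 ((hp _ _).1 (T'.pair_inl s))
  rw [h1, he, hf]

/-- The matrix `(e_u - e_v)(e_u - e_v)ᵀ`. -/
def diffMatrix {σ : ℕ} (u v j k : Fin σ) : ℂ :=
  ((if j = u then 1 else 0) - (if j = v then 1 else 0)) *
    ((if k = u then 1 else 0) - (if k = v then 1 else 0))

open Classical in
lemma Term.diffMatrix_matching {σ : ℕ} {T : Term σ 0 0} (hT : T.NoTraces) (u v : Fin σ)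
    (s : T.HoloIdx) :
    diffMatrix u v s.1 (T.matching s).1 = if T.IsLink u v s then -1 else 0 := by
  have h := hT s _ (T.pair_inl s)
  simp only [diffMatrix, Term.IsLink]
  grind

open Classical Polynomial in
lemma Term.coeff_prod_add_diffMatrix {σ : ℕ} {T : Term σ 0 0} (hT : T.NoTraces) {u v : Fin σ}
    {M : ℕ} (hM : T.linkCount u v ≤ M) (H : Fin σ → Fin σ → ℂ) :
    (∏ s : T.HoloIdx,
      (C (H s.1 (T.matching s).1) + C (diffMatrix u v s.1 (T.matching s).1) * X)).coeff M =
      if T.linkCount u v = M then (-1) ^ M *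
        ∏ s ∈ Finset.univ.filter (fun s => ¬ T.IsLink u v s), H s.1 (T.matching s).1 else 0 := by
  rw [← Finset.prod_filter_mul_prod_filter_not Finset.univ (T.IsLink u v)]
  have h1 : ∏ s ∈ Finset.univ.filter (fun s => ¬ T.IsLink u v s),
      (C (H s.1 (T.matching s).1) + C (diffMatrix u v s.1 (T.matching s).1) * X) =
      C (∏ s ∈ Finset.univ.filter (fun s => ¬ T.IsLink u v s), H s.1 (T.matching s).1) := by
    rw [map_prod]
    refine Finset.prod_congr rfl fun s hs => ?_
    rw [diffMatrix_matching hT, if_neg (Finset.mem_filter.1 hs).2]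
    simp
  have hdeg (s : T.HoloIdx) : (C (H s.1 (T.matching s).1) +
      C (diffMatrix u v s.1 (T.matching s).1) * X).natDegree ≤ 1 := by
    rw [add_comm]
    exact natDegree_linear_le
  rw [h1, coeff_mul_C]
  split_ifs with h
  · congr 1
    have h2 := coeff_prod_of_natDegree_le (Finset.univ.filter (T.IsLink u v)) _ 1 fun s _ => hdeg s
    rw [← T.linkCount_eq_card, h, mul_one] at h2
    rw [h2, ← h, T.linkCount_eq_card, ← Finset.prod_const]
    refine Finset.prod_congr rfl fun s hs => ?_
    rw [diffMatrix_matching hT, if_pos (Finset.mem_filter.1 hs).2]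
    simp
  · rw [coeff_eq_zero_of_natDegree_lt, zero_mul]
    refine ((natDegree_prod_le _ _).trans
      (Finset.sum_le_card_nsmul _ _ 1 fun s _ => hdeg s)).trans_lt ?_
    rw [← T.linkCount_eq_card, smul_eq_mul, mul_one]
    omega

lemma sum_diffMatrix_left {σ : ℕ} (u v k : Fin σ) : ∑ j, diffMatrix u v j k = 0 := by
  simp [diffMatrix, ← Finset.sum_mul]

lemma sum_diffMatrix_right {σ : ℕ} (u v j : Fin σ) : ∑ k, diffMatrix u v j k = 0 := by
  simp [diffMatrix, ← Finset.mul_sum]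

open Classical Polynomial in
/-- The part of the symbol with the maximal number of links, with these links erased, vanishes
wherever all total symbols do. -/
lemma sum_maximal_erased_eq_zero {σ n : ℕ} (hn : σ ≤ n + 1) {L : LinComb σ 0 0}
    (htr : ∀ r, (L.term r).NoTraces) (hint : IntegratesToZero n L) {u v : Fin σ} {M : ℕ}
    (hM : ∀ r, (L.term r).linkCount u v ≤ M) {w : Fin σ × (Fin n ⊕ Fin n) → ℂ}
    (hw : ∀ i, ∑ j, w (j, i) = 0) :
    ∑ r, (if (L.term r).linkCount u v = M then L.coeff r *
      ∏ s ∈ Finset.univ.filter (fun s => ¬ (L.term r).IsLink u v s),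
        gram w s.1 ((L.term r).matching s).1 else 0) = 0 := by
  have hz : ∑ r, C (L.coeff r) * ∏ s : (L.term r).HoloIdx,
      (C (gram w s.1 ((L.term r).matching s).1) +
        C (diffMatrix u v s.1 ((L.term r).matching s).1) * X) = 0 := by
    refine Polynomial.funext fun t => ?_
    obtain ⟨w', hw', hg⟩ := exists_gram_eq (n := n) u hn
      (fun j k => gram w j k + diffMatrix u v j k * t)
      (fun k => by
        rw [Finset.sum_add_distrib, ← Finset.sum_mul, sum_gram_left hw, sum_diffMatrix_left]
        simp)
      (fun j => by
        rw [Finset.sum_add_distrib, ← Finset.sum_mul, sum_gram_right hw, sum_diffMatrix_right]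
        simp)
    have h := (integratesToZero_iff u L).1 hint w' hw'
    rw [L.eval_symbol, hg] at h
    simpa [eval_finsetSum, eval_prod] using h
  have hc := congrArg (fun p => p.coeff M) hz
  simp only [finsetSum_coeff, coeff_C_mul, coeff_zero,
    Term.coeff_prod_add_diffMatrix (htr _) (hM _)] at hc
  refine (mul_eq_zero.1 (Eq.trans ?_ hc)).resolve_left (pow_ne_zero M (neg_ne_zero.2 one_ne_zero))
  rw [Finset.mul_sum]
  refine Finset.sum_congr rfl fun r _ => ?_
  split_ifs <;> ring

/-- Lemma 2.11: if `L(Ψ)` has no traces and integrates to zero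
in dimension `n ≥ σ - 1`, and `L̃(Ψ)` is obtained from the terms of `L(Ψ)`
with the maximal number `M` of contractions between the first and the last
factor by erasing those `M` contracted index pairs, then `L̃(Ψ)` also
integrates to zero in dimension `n`. -/
theorem erased_integrates_to_zero {σ n : ℕ} (hσ : 0 < σ) (hn : σ ≤ n + 1)
    (L : LinComb σ 0 0)
    (htr : ∀ r, (L.term r).NoTraces)
    (hint : IntegratesToZero n L)
    (M : ℕ)
    (hM : ∀ r, (L.term r).linkCount ⟨0, hσ⟩ ⟨σ - 1, by omega⟩ ≤ M)
    (hach : ∃ r, (L.term r).linkCount ⟨0, hσ⟩ ⟨σ - 1, by omega⟩ = M)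
    (Lt : LinComb σ 0 0)
    (g : Fin Lt.N ≃
      {r : Fin L.N // (L.term r).linkCount ⟨0, hσ⟩ ⟨σ - 1, by omega⟩ = M})
    (hco : ∀ i, Lt.coeff i = L.coeff (g i))
    (her : ∀ i, ErasesLinks ⟨0, hσ⟩ ⟨σ - 1, by omega⟩ (L.term (g i)) (Lt.term i)) :
    IntegratesToZero n Lt := by
  classical
  refine (integratesToZero_iff ⟨0, hσ⟩ Lt).2 fun w hw => ?_
  rw [Lt.eval_symbol, ← sum_maximal_erased_eq_zero hn htr hint hM hw, ← Finset.sum_filter,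
    Finset.sum_subtype (p := fun r => (L.term r).linkCount ⟨0, hσ⟩ ⟨σ - 1, by omega⟩ = M) _
      (by simp)]
  refine Fintype.sum_equiv g _ _ fun i => ?_
  rw [hco, (her i).prod_eq]

end KahlerInv
end
end

section
/- Let 𝓛 be a restriction list and let C(Ψ) be an 𝓛-acceptable complete contraction in which the factor ∂^{(A_i,B_i)}ψ^i is non-minimal (i.e., (A_i,B_i) ≠ (α_i,β_i)) and contains at least one trace. Then there exist one-form valued 𝓛-acceptable invariants T_a(Ψ) and T_ā(Ψ) such that C(Ψ) − ∂_ā T_a(Ψ) − ∂_a T_ā(Ψ) = L′(Ψ), where L′(Ψ) is a finite linear combination of 𝓛-acceptable complete contractions in each of whose terms the factor on ψ^i is either minimal or contains no trace, and in which the number of traces in every other factor is unchanged from C(Ψ). -/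
open MeasureTheory

noncomputable section

namespace KahlerInv

open scoped ContDiff

/-! ### Wirtinger operators on smooth functions -/

/-- The common form of the Wirtinger operators: `(∂_u f + c ∂_w f) / 2`. -/
def dirOp {n : ℕ} (c : ℂ) (u w : Fin n → ℂ) (f : (Fin n → ℂ) → ℂ) : (Fin n → ℂ) → ℂ :=
  fun z => (1 / 2 : ℂ) * (fderiv ℝ f z u + c * fderiv ℝ f z w)

lemma dz_eq_dirOp {n : ℕ} (a : Fin n) :
    dz n a = dirOp (-Complex.I) (Pi.single a 1) (Pi.single a Complex.I) := by
  funext f z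
  simp only [dz, dirOp]
  ring

lemma dzbar_eq_dirOp {n : ℕ} (a : Fin n) :
    dzbar n a = dirOp Complex.I (Pi.single a 1) (Pi.single a Complex.I) := rfl

lemma contDiff_fderiv_apply_const {n : ℕ} {f : (Fin n → ℂ) → ℂ} (hf : ContDiff ℝ ∞ f)
    (u : Fin n → ℂ) : ContDiff ℝ ∞ (fun z => fderiv ℝ f z u) :=
  (hf.fderiv_right (m := ∞) (by simp)).clm_apply contDiff_const

lemma contDiff_dirOp {n : ℕ} (c : ℂ) (u w : Fin n → ℂ) {f : (Fin n → ℂ) → ℂ}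
    (hf : ContDiff ℝ ∞ f) : ContDiff ℝ ∞ (dirOp c u w f) :=
  contDiff_const.mul ((contDiff_fderiv_apply_const hf u).add
    (contDiff_const.mul (contDiff_fderiv_apply_const hf w)))

lemma fderiv_dirOp {n : ℕ} (c : ℂ) (u w : Fin n → ℂ) {f : (Fin n → ℂ) → ℂ}
    (hf : ContDiff ℝ ∞ f) (z x : Fin n → ℂ) :
    fderiv ℝ (dirOp c u w f) z x = (1 / 2 : ℂ) *
      (fderiv ℝ (fderiv ℝ f) z x u + c * fderiv ℝ (fderiv ℝ f) z x w) := by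
  have hd : DifferentiableAt ℝ (fderiv ℝ f) z :=
    ((hf.fderiv_right (m := ∞) (by simp)).differentiable (by simp)) z
  have hu : ∀ y, HasFDerivAt (fun z => fderiv ℝ f z y)
      ((fderiv ℝ (fderiv ℝ f) z).flip y) z := fun y => by
    simpa using hd.hasFDerivAt.clm_apply (hasFDerivAt_const y z)
  have h := (((hu u).add ((hu w).const_mul c)).const_mul (1 / 2 : ℂ)).fderiv
  have h' : fderiv ℝ (dirOp c u w f) z = _ := h
  rw [h']
  simp [mul_add]

lemma dirOp_comm {n : ℕ} (c c' : ℂ) (u w u' w' : Fin n → ℂ) {f : (Fin n → ℂ) → ℂ}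
    (hf : ContDiff ℝ ∞ f) :
    dirOp c u w (dirOp c' u' w' f) = dirOp c' u' w' (dirOp c u w f) := by
  funext z
  have hs : ∀ x y, fderiv ℝ (fderiv ℝ f) z x y = fderiv ℝ (fderiv ℝ f) z y x := fun x y =>
    (hf.contDiffAt.isSymmSndFDerivAt (by simpa using WithTop.coe_le_coe.2 (le_top : (2 : ℕ∞) ≤ ⊤))) x y
  simp only [dirOp.eq_1 _ _ _ (dirOp _ _ _ _), fderiv_dirOp _ _ _ hf]
  rw [hs u' u, hs u' w, hs w' u, hs w' w]
  ring

lemma contDiff_dz {n : ℕ} (a : Fin n) {f : (Fin n → ℂ) → ℂ} (hf : ContDiff ℝ ∞ f) :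
    ContDiff ℝ ∞ (dz n a f) := by
  rw [dz_eq_dirOp]
  exact contDiff_dirOp _ _ _ hf

lemma contDiff_dzbar {n : ℕ} (a : Fin n) {f : (Fin n → ℂ) → ℂ} (hf : ContDiff ℝ ∞ f) :
    ContDiff ℝ ∞ (dzbar n a f) :=
  contDiff_dirOp _ _ _ hf

lemma dz_comm {n : ℕ} (a b : Fin n) {f : (Fin n → ℂ) → ℂ} (hf : ContDiff ℝ ∞ f) :
    dz n a (dz n b f) = dz n b (dz n a f) := by
  simp only [dz_eq_dirOp, dirOp_comm _ _ _ _ _ _ hf]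

lemma dzbar_comm {n : ℕ} (a b : Fin n) {f : (Fin n → ℂ) → ℂ} (hf : ContDiff ℝ ∞ f) :
    dzbar n a (dzbar n b f) = dzbar n b (dzbar n a f) := by
  simp only [dzbar_eq_dirOp, dirOp_comm _ _ _ _ _ _ hf]

lemma dz_dzbar_comm {n : ℕ} (a b : Fin n) {f : (Fin n → ℂ) → ℂ} (hf : ContDiff ℝ ∞ f) :
    dz n a (dzbar n b f) = dzbar n b (dz n a f) := by
  simp only [dz_eq_dirOp, dzbar_eq_dirOp]
  exact dirOp_comm _ _ _ _ _ _ hf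

lemma dirOp_sum_mul_prod {n : ℕ} {ι κ : Type*} [Fintype ι] [Fintype κ] [DecidableEq κ]
    (c : ℂ) (u w : Fin n → ℂ) (r : ι → ℂ) (g : ι → κ → (Fin n → ℂ) → ℂ)
    (hg : ∀ v j, ContDiff ℝ ∞ (g v j)) (z : Fin n → ℂ) :
    dirOp c u w (fun x => ∑ v, r v * ∏ j, g v j x) z =
      ∑ v, r v * ∑ l, (∏ j ∈ Finset.univ.erase l, g v j z) * dirOp c u w (g v l) z := by
  have hd : ∀ v j, HasFDerivAt (g v j) (fderiv ℝ (g v j) z) z := fun v j =>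
    (((hg v j).differentiable (by simp)) z).hasFDerivAt
  have h := (HasFDerivAt.fun_sum (u := Finset.univ) fun v _ =>
    (HasFDerivAt.finsetProd (u := Finset.univ) fun j _ => hd v j).const_mul (r v)).fderiv
  simp only [dirOp, h]
  simp only [sum_apply, smul_apply, smul_eq_mul,
    Finset.mul_sum, ← Finset.sum_add_distrib]
  refine Finset.sum_congr rfl fun v _ => Finset.sum_congr rfl fun l _ => ?_
  ring

lemma dirOp_add {n : ℕ} (c : ℂ) (u w : Fin n → ℂ) {f g : (Fin n → ℂ) → ℂ}
    (hf : ContDiff ℝ ∞ f) (hg : ContDiff ℝ ∞ g) (z : Fin n → ℂ) :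
    dirOp c u w (fun x => f x + g x) z = dirOp c u w f z + dirOp c u w g z := by
  simp only [dirOp, fderiv_fun_add (hf.differentiable (by simp) z)
    (hg.differentiable (by simp) z), add_apply]
  ring

lemma dirOp_neg {n : ℕ} (c : ℂ) (u w : Fin n → ℂ) (f : (Fin n → ℂ) → ℂ) (z : Fin n → ℂ) :
    dirOp c u w (fun x => -f x) z = -dirOp c u w f z := by
  simp only [dirOp, fderiv_fun_neg, neg_apply]
  ring

/-! ### Iterated derivatives indexed by multisets -/

lemma contDiff_foldr {n : ℕ} {D : Fin n → ((Fin n → ℂ) → ℂ) → (Fin n → ℂ) → ℂ}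
    (hD : ∀ a f, ContDiff ℝ ∞ f → ContDiff ℝ ∞ (D a f)) (l : List (Fin n))
    {f : (Fin n → ℂ) → ℂ} (hf : ContDiff ℝ ∞ f) :
    ContDiff ℝ ∞ (l.foldr D f) := by
  induction l with
  | nil => exact hf
  | cons a l ih => exact hD a _ ih

lemma foldr_perm {n : ℕ} {D : Fin n → ((Fin n → ℂ) → ℂ) → (Fin n → ℂ) → ℂ}
    (hD : ∀ a f, ContDiff ℝ ∞ f → ContDiff ℝ ∞ (D a f))
    (hc : ∀ a b f, ContDiff ℝ ∞ f → D a (D b f) = D b (D a f))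
    {l l' : List (Fin n)} (hl : l.Perm l') {f : (Fin n → ℂ) → ℂ} (hf : ContDiff ℝ ∞ f) :
    l.foldr D f = l'.foldr D f := by
  induction hl with
  | nil => rfl
  | cons a _ ih => simp only [List.foldr_cons, ih]
  | swap a b l => exact hc _ _ _ (contDiff_foldr hD l hf)
  | trans _ _ ih ih' => exact ih.trans ih'

lemma foldr_dz_dzbar {n : ℕ} (l : List (Fin n)) (b : Fin n)
    {f : (Fin n → ℂ) → ℂ} (hf : ContDiff ℝ ∞ f) :
    l.foldr (dz n) (dzbar n b f) = dzbar n b (l.foldr (dz n) f) := by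
  induction l with
  | nil => rfl
  | cons a l ih =>
    rw [List.foldr_cons, List.foldr_cons, ih,
      dz_dzbar_comm _ _ (contDiff_foldr (fun a _ => contDiff_dz a) l hf)]

/-- The mixed Wirtinger derivative with prescribed multisets of indices. -/
def multiDeriv (n : ℕ) (s t : Multiset (Fin n)) (f : (Fin n → ℂ) → ℂ) : (Fin n → ℂ) → ℂ :=
  s.toList.foldr (dz n) (t.toList.foldr (dzbar n) f)

lemma contDiff_multiDeriv {n : ℕ} (s t : Multiset (Fin n)) {f : (Fin n → ℂ) → ℂ}
    (hf : ContDiff ℝ ∞ f) : ContDiff ℝ ∞ (multiDeriv n s t f) :=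
  contDiff_foldr (fun a _ => contDiff_dz a) _ (contDiff_foldr (fun a _ => contDiff_dzbar a) _ hf)

lemma foldr_eq_multiDeriv {n : ℕ} (l l' : List (Fin n)) {f : (Fin n → ℂ) → ℂ}
    (hf : ContDiff ℝ ∞ f) :
    l.foldr (dz n) (l'.foldr (dzbar n) f) = multiDeriv n l l' f := by
  have h : l'.foldr (dzbar n) f = (l' : Multiset (Fin n)).toList.foldr (dzbar n) f :=
    foldr_perm (fun a _ => contDiff_dzbar a) (fun a b _ => dzbar_comm a b)
      (Multiset.coe_eq_coe.1 (Multiset.coe_toList _).symm) hf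
  rw [multiDeriv, h]
  exact foldr_perm (fun a _ => contDiff_dz a) (fun a b _ => dz_comm a b)
    (Multiset.coe_eq_coe.1 (Multiset.coe_toList _).symm)
    (contDiff_foldr (fun a _ => contDiff_dzbar a) _ hf)

lemma mixedDeriv_eq_multiDeriv {n A B : ℕ} (hs : Fin A → Fin n) (as : Fin B → Fin n)
    {f : (Fin n → ℂ) → ℂ} (hf : ContDiff ℝ ∞ f) :
    mixedDeriv n hs as f =
      multiDeriv n (Finset.univ.val.map hs) (Finset.univ.val.map as) f := by
  rw [Fin.univ_val_map, Fin.univ_val_map, ← foldr_eq_multiDeriv _ _ hf]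
  rfl

lemma multiDeriv_cons_left {n : ℕ} (a : Fin n) (s t : Multiset (Fin n))
    {f : (Fin n → ℂ) → ℂ} (hf : ContDiff ℝ ∞ f) :
    multiDeriv n (a ::ₘ s) t f = dz n a (multiDeriv n s t f) := by
  have h := foldr_eq_multiDeriv (a :: s.toList) t.toList hf
  rw [← Multiset.cons_coe, Multiset.coe_toList, Multiset.coe_toList] at h
  rw [← h]
  rfl

lemma multiDeriv_cons_right {n : ℕ} (b : Fin n) (s t : Multiset (Fin n))
    {f : (Fin n → ℂ) → ℂ} (hf : ContDiff ℝ ∞ f) :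
    multiDeriv n s (b ::ₘ t) f = dzbar n b (multiDeriv n s t f) := by
  have h := foldr_eq_multiDeriv s.toList (b :: t.toList) hf
  rw [← Multiset.cons_coe, Multiset.coe_toList, Multiset.coe_toList] at h
  rw [← h, List.foldr_cons,
    foldr_dz_dzbar _ _ (contDiff_foldr (fun a _ => contDiff_dzbar a) _ hf)]
  rfl

lemma SmoothCpt.contDiff_ofReal {n : ℕ} {f : (Fin n → ℂ) → ℝ} (hf : SmoothCpt n f) :
    ContDiff ℝ ∞ (fun w => (f w : ℂ)) :=
  Complex.ofRealCLM.contDiff.comp hf.1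

/-! ### Contractions as sets of edges -/

section Edges

variable {σ p q : ℕ} {E : Type} [Fintype E]

/-- The multiset of values of `v` on the edges attached to factor `j`. -/
def fiberVals {n : ℕ} (h : E → Option (Fin σ)) (j : Fin σ) (v : E → Fin n) :
    Multiset (Fin n) :=
  (Finset.univ.filter fun e => h e = some j).val.map v

/-- The product of the factors of a contraction whose edges `e` join a holomorphic slot of the
factor `h e` to an anti-holomorphic slot of `k e`, for fixed values `v` of the indices. -/
def edgeFactor (n : ℕ) (h k : E → Option (Fin σ)) (Ψ : Fin σ → (Fin n → ℂ) → ℝ)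
    (v : E → Fin n) (j : Fin σ) : (Fin n → ℂ) → ℂ :=
  multiDeriv n (fiberVals h j v) (fiberVals k j v) (fun w => (Ψ j w : ℂ))

/-- The sum over all index values of the product of the factors. -/
def edgeEval (n : ℕ) (h k : E → Option (Fin σ)) (Ψ : Fin σ → (Fin n → ℂ) → ℝ)
    (z : Fin n → ℂ) : ℂ :=
  open Classical in ∑ v : E → Fin n, ∏ j, edgeFactor n h k Ψ v j z

lemma contDiff_edgeFactor {n : ℕ} (h k : E → Option (Fin σ)) {Ψ : Fin σ → (Fin n → ℂ) → ℝ}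
    (hΨ : ∀ j, SmoothCpt n (Ψ j)) (v : E → Fin n) (j : Fin σ) :
    ContDiff ℝ ∞ (edgeFactor n h k Ψ v j) :=
  contDiff_multiDeriv _ _ (hΨ j).contDiff_ofReal

/-- An identification of the index pairs (free indices included) of a contraction with `E`, such
that `h` and `k` give the factors of the two ends, `none` standing for a free end. -/
structure EdgePresentation (T : Term σ p q) (h k : E → Option (Fin σ)) where
  equiv : T.HoloIdx ⊕ Fin q ≃ E
  holo : ∀ x, h (equiv x) = Sum.elim (fun s => some s.1) (fun _ => none) x
  anti : ∀ x, k (equiv x) = Sum.elim (fun t => some t.1) (fun _ => none) (T.pair x)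

lemma exists_slot_equiv (h : E → Option (Fin σ))
    (hq : (Finset.univ.filter fun e => h e = none).card = q) :
    ∃ (A : Fin σ → ℕ) (φ : (Σ j : Fin σ, Fin (A j)) ⊕ Fin q ≃ E),
      ∀ x, h (φ x) = Sum.elim (fun s => some s.1) (fun _ => none) x := by
  let ψ (j : Fin σ) := Fintype.equivFin {e // h e = some j}
  let χ := Fintype.equivFinOfCardEq ((Fintype.card_subtype fun e => h e = none).trans hq)
  let f : (Σ j : Fin σ, Fin (Fintype.card {e // h e = some j})) ⊕ Fin q → E :=
    Sum.elim (fun s => ((ψ s.1).symm s.2).1) (fun i => (χ.symm i).1)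
  have hf : ∀ x, h (f x) = Sum.elim (fun s => some s.1) (fun _ => none) x := by
    rintro (⟨j, s⟩ | i)
    · exact ((ψ j).symm s).2
    · exact (χ.symm i).2
  refine ⟨_, Equiv.ofBijective f ⟨fun x y hxy => ?_, fun e => ?_⟩, hf⟩
  · have h' := (hf x).symm.trans ((congrArg h hxy).trans (hf y))
    rcases x with ⟨j, s⟩ | i <;> rcases y with ⟨l, t⟩ | i'
    · obtain rfl : j = l := by simpa using h'
      obtain rfl : s = t := (ψ j).symm.injective (Subtype.ext hxy)
      rfl
    · simp at h'
    · simp at h'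
    · obtain rfl : i = i' := χ.symm.injective (Subtype.ext hxy)
      rfl
  · rcases he : h e with _ | j
    · exact ⟨Sum.inr (χ ⟨e, he⟩), by simp [f]⟩
    · exact ⟨Sum.inl ⟨j, ψ j ⟨e, he⟩⟩, by simp [f]⟩

lemma exists_edgePresentation (h k : E → Option (Fin σ))
    (hq : (Finset.univ.filter fun e => h e = none).card = q)
    (hp : (Finset.univ.filter fun e => k e = none).card = p)
    (hhk : ∀ e, h e = none → k e ≠ none) :
    ∃ T : Term σ p q, Nonempty (EdgePresentation T h k) := by
  obtain ⟨A, φ, hφ⟩ := exists_slot_equiv h hq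
  obtain ⟨B, χ, hχ⟩ := exists_slot_equiv k hp
  refine ⟨⟨A, B, φ.trans χ.symm, fun i => ?_, fun i => ?_⟩, ⟨φ, hφ, fun x => ?_⟩⟩
  · have h₁ := hhk _ (hφ (Sum.inr i))
    have h₂ := hχ (χ.symm (φ (Sum.inr i)))
    rw [Equiv.apply_symm_apply] at h₂
    rw [h₂] at h₁
    rcases h₃ : χ.symm (φ (Sum.inr i)) with t | t
    · simp [h₃]
    · simp [h₃] at h₁
  · have h₁ := fun hn => hhk _ hn (hχ (Sum.inr i))
    have h₂ := hφ (φ.symm (χ (Sum.inr i)))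
    rw [Equiv.apply_symm_apply] at h₂
    rw [h₂] at h₁
    rcases h₃ : φ.symm (χ (Sum.inr i)) with t | t
    · simp [h₃]
    · simp [h₃] at h₁
  · have h₂ := hχ (χ.symm (φ x))
    rwa [Equiv.apply_symm_apply] at h₂

namespace EdgePresentation

variable {T : Term σ p q} {h k : E → Option (Fin σ)}

lemma map_holo {n : ℕ} (P : EdgePresentation T h k) (v : E → Fin n) (j : Fin σ) :
    Finset.univ.val.map (fun s : Fin (T.A j) => v (P.equiv (Sum.inl ⟨j, s⟩))) =
      fiberVals h j v := by
  have hi : Function.Injective fun s : Fin (T.A j) => P.equiv (Sum.inl ⟨j, s⟩) := fun s t hst => by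
    simpa using hst
  have hf : (Finset.univ.filter fun e => h e = some j) = Finset.univ.map ⟨_, hi⟩ := by
    ext e
    obtain ⟨x, rfl⟩ := P.equiv.surjective e
    simp only [Finset.mem_filter, Finset.mem_univ, true_and, P.holo, Finset.mem_map,
      Function.Embedding.coeFn_mk, EmbeddingLike.apply_eq_iff_eq]
    rcases x with ⟨l, s⟩ | i
    · constructor
      · rintro hl
        obtain rfl : l = j := by simpa using hl
        exact ⟨s, rfl⟩
      · rintro ⟨s, hs⟩
        cases hs
        rfl
    · simp
  rw [fiberVals, hf, Finset.map_val, Multiset.map_map]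
  rfl

lemma map_anti {n : ℕ} (P : EdgePresentation T h k) (v : E → Fin n) (j : Fin σ) :
    Finset.univ.val.map (fun t : Fin (T.B j) => v (P.equiv (T.pair.symm (Sum.inl ⟨j, t⟩)))) =
      fiberVals k j v := by
  have hi : Function.Injective
      fun t : Fin (T.B j) => P.equiv (T.pair.symm (Sum.inl ⟨j, t⟩)) := fun s t hst => by
    simpa using hst
  have hf : (Finset.univ.filter fun e => k e = some j) = Finset.univ.map ⟨_, hi⟩ := by
    ext e
    obtain ⟨x, rfl⟩ := (T.pair.symm.trans P.equiv).surjective e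
    simp only [Finset.mem_filter, Finset.mem_univ, true_and, P.anti, Finset.mem_map,
      Function.Embedding.coeFn_mk, EmbeddingLike.apply_eq_iff_eq, Equiv.trans_apply,
      Equiv.apply_symm_apply]
    rcases x with ⟨l, s⟩ | i
    · constructor
      · rintro hl
        obtain rfl : l = j := by simpa using hl
        exact ⟨s, rfl⟩
      · rintro ⟨s, hs⟩
        cases hs
        rfl
    · simp
  rw [fiberVals, hf, Finset.map_val, Multiset.map_map]
  rfl

lemma A_eq (P : EdgePresentation T h k) (j : Fin σ) :
    T.A j = (Finset.univ.filter fun e => h e = some j).card := by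
  have H := congrArg Multiset.card (P.map_holo (fun _ => (0 : Fin 1)) j)
  rw [Multiset.card_map, fiberVals, Multiset.card_map] at H
  exact (Finset.card_fin _).symm.trans H

lemma B_eq (P : EdgePresentation T h k) (j : Fin σ) :
    T.B j = (Finset.univ.filter fun e => k e = some j).card := by
  have H := congrArg Multiset.card (P.map_anti (fun _ => (0 : Fin 1)) j)
  rw [Multiset.card_map, fiberVals, Multiset.card_map] at H
  exact (Finset.card_fin _).symm.trans H

lemma tracesAt_eq (P : EdgePresentation T h k) (j : Fin σ) :
    T.tracesAt j = (Finset.univ.filter fun e => h e = some j ∧ k e = some j).card := by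
  classical
  rw [Term.tracesAt]
  refine Finset.card_bij (fun s _ => P.equiv (Sum.inl s)) ?_ ?_ ?_
  · rintro ⟨l, s⟩ hs
    simp only [Finset.mem_filter, Finset.mem_univ, true_and] at hs ⊢
    obtain ⟨rfl, t, ht, hl⟩ := hs
    simp [P.holo, P.anti, ht, hl]
  · intro s _ t _ hst
    simpa using hst
  · intro e he
    obtain ⟨x, rfl⟩ := P.equiv.surjective e
    simp only [Finset.mem_filter, Finset.mem_univ, true_and, P.holo, P.anti] at he
    rcases x with s | i
    · refine ⟨s, ?_, rfl⟩
      simp only [Finset.mem_filter, Finset.mem_univ, true_and]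
      refine ⟨by simpa using he.1, ?_⟩
      rcases ht : T.pair (Sum.inl s) with t | i
      · exact ⟨t, rfl, by simpa [ht] using he.2⟩
      · simp [ht] at he
    · simp at he

open Classical in
lemma eval_eq {n : ℕ} (P : EdgePresentation T h k) {Ψ : Fin σ → (Fin n → ℂ) → ℝ}
    (hΨ : ∀ j, SmoothCpt n (Ψ j)) (fh : Fin p → Fin n) (fa : Fin q → Fin n)
    (R : Fin n → Prop) (hh : ∀ i x, x = fh i ↔ R x) (ha : ∀ i x, x = fa i ↔ R x)
    (z : Fin n → ℂ) :
    T.eval n Ψ fh fa z = ∑ v : E → Fin n,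
      (if ∀ e, h e = none ∨ k e = none → R (v e) then 1 else 0) *
        ∏ j, edgeFactor n h k Ψ v j z := by
  rw [Term.eval]
  refine (Fintype.sum_equiv (P.equiv.arrowCongr (Equiv.refl (Fin n))).symm _ _ fun v => ?_).symm
  have hc : (∀ e, h e = none ∨ k e = none → R (v e)) ↔
      (∀ i : Fin q, v (P.equiv (Sum.inr i)) = fa i) ∧
        ∀ (s : T.HoloIdx) (i : Fin p), T.pair (Sum.inl s) = Sum.inr i →
          v (P.equiv (Sum.inl s)) = fh i := by
    simp only [ha, hh]
    rw [← P.equiv.forall_congr_right]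
    simp only [P.holo, P.anti]
    constructor
    · exact fun H => ⟨fun i => H _ (Or.inl rfl), fun s i hs => H _ (Or.inr (by simp [hs]))⟩
    · rintro ⟨H₁, H₂⟩ (s | i) hx
      · rcases ht : T.pair (Sum.inl s) with t | i
        · simp [ht] at hx
        · exact H₂ s i ht
      · exact H₁ i
  congr 1
  · exact if_congr hc rfl rfl
  · refine Finset.prod_congr rfl fun j _ => ?_
    rw [mixedDeriv_eq_multiDeriv _ _ (hΨ j).contDiff_ofReal, edgeFactor, ← P.map_holo, ← P.map_anti]
    rfl

end EdgePresentation

/-- Every complete contraction is presented by its own set of index pairs. -/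
lemma exists_presentation (T : Term σ 0 0) :
    ∃ h k : T.HoloIdx → Fin σ,
      Nonempty (EdgePresentation T (fun e => some (h e)) (fun e => some (k e))) := by
  let φ : T.HoloIdx ⊕ Fin 0 ≃ T.HoloIdx := Equiv.sumEmpty _ _
  let χ : T.AntiIdx ⊕ Fin 0 ≃ T.AntiIdx := Equiv.sumEmpty _ _
  refine ⟨fun e => e.1, fun e => (χ (T.pair (φ.symm e))).1, ⟨⟨φ, ?_, ?_⟩⟩⟩
  · rintro (s | i)
    · rfl
    · exact i.elim0
  · intro x
    simp only [Equiv.symm_apply_apply]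
    rcases T.pair x with t | i
    · rfl
    · exact i.elim0
/-! ### Divergences of one-forms -/

open Classical in
lemma fiberVals_update {n : ℕ} (h : E → Fin σ) (e₀ : E) (l j : Fin σ) (v : E → Fin n) :
    fiberVals (fun e => some (Function.update h e₀ l e)) j v =
      if j = l then v e₀ ::ₘ fiberVals (Function.update (fun e => some (h e)) e₀ none) j v
      else fiberVals (Function.update (fun e => some (h e)) e₀ none) j v := by
  have hmem : e₀ ∉ Finset.univ.filter fun e =>
      Function.update (fun e => some (h e)) e₀ none e = some j := by simp
  split_ifs with hj
  · subst hj
    rw [fiberVals, fiberVals, ← Multiset.map_cons, ← Finset.cons_val hmem]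
    congr 2
    ext e
    by_cases he : e = e₀ <;> simp [he]
  · rw [fiberVals, fiberVals]
    congr 2
    ext e
    by_cases he : e = e₀ <;> simp [he, Ne.symm hj]

open Classical in
lemma prod_edgeFactor_update_holo {n : ℕ} (h : E → Fin σ) (k : E → Option (Fin σ)) (e₀ : E)
    {Ψ : Fin σ → (Fin n → ℂ) → ℝ} (hΨ : ∀ j, SmoothCpt n (Ψ j)) (v : E → Fin n)
    (z : Fin n → ℂ) (l : Fin σ) :
    ∏ j, edgeFactor n (fun e => some (Function.update h e₀ l e)) k Ψ v j z =
      (∏ j ∈ Finset.univ.erase l,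
        edgeFactor n (Function.update (fun e => some (h e)) e₀ none) k Ψ v j z) *
      dz n (v e₀) (edgeFactor n (Function.update (fun e => some (h e)) e₀ none) k Ψ v l) z := by
  rw [← Finset.prod_erase_mul _ _ (Finset.mem_univ l)]
  congr 1
  · refine Finset.prod_congr rfl fun j hj => ?_
    rw [edgeFactor, fiberVals_update, if_neg (Finset.ne_of_mem_erase hj), edgeFactor]
  · rw [edgeFactor, fiberVals_update, if_pos rfl,
      multiDeriv_cons_left _ _ _ (hΨ l).contDiff_ofReal]
    rfl

open Classical in
lemma prod_edgeFactor_update_anti {n : ℕ} (h : E → Option (Fin σ)) (k : E → Fin σ) (e₀ : E)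
    {Ψ : Fin σ → (Fin n → ℂ) → ℝ} (hΨ : ∀ j, SmoothCpt n (Ψ j)) (v : E → Fin n)
    (z : Fin n → ℂ) (l : Fin σ) :
    ∏ j, edgeFactor n h (fun e => some (Function.update k e₀ l e)) Ψ v j z =
      (∏ j ∈ Finset.univ.erase l,
        edgeFactor n h (Function.update (fun e => some (k e)) e₀ none) Ψ v j z) *
      dzbar n (v e₀) (edgeFactor n h (Function.update (fun e => some (k e)) e₀ none) Ψ v l) z := by
  rw [← Finset.prod_erase_mul _ _ (Finset.mem_univ l)]
  congr 1
  · refine Finset.prod_congr rfl fun j hj => ?_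
    rw [edgeFactor, fiberVals_update, if_neg (Finset.ne_of_mem_erase hj), edgeFactor]
  · rw [edgeFactor, fiberVals_update, if_pos rfl,
      multiDeriv_cons_right _ _ _ (hΨ l).contDiff_ofReal]
    rfl

open Classical in
lemma EdgePresentation.eval_complete {n : ℕ} {T : Term σ 0 0} {h k : E → Fin σ}
    (P : EdgePresentation T (fun e => some (h e)) (fun e => some (k e)))
    {Ψ : Fin σ → (Fin n → ℂ) → ℝ} (hΨ : ∀ j, SmoothCpt n (Ψ j)) (z : Fin n → ℂ) :
    T.eval n Ψ noFree noFree z =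
      edgeEval n (fun e => some (h e)) (fun e => some (k e)) Ψ z := by
  rw [P.eval_eq hΨ noFree noFree (fun _ => True) (fun i => i.elim0) (fun i => i.elim0)]
  simp [edgeEval]

open Classical in
lemma EdgePresentation.sum_dz_eval {n : ℕ} {T : Term σ 0 1} {h k : E → Fin σ} {e₀ : E}
    (P : EdgePresentation T (Function.update (fun e => some (h e)) e₀ none)
      (fun e => some (k e)))
    {Ψ : Fin σ → (Fin n → ℂ) → ℝ} (hΨ : ∀ j, SmoothCpt n (Ψ j)) (z : Fin n → ℂ) :
    ∑ a, dz n a (fun w => T.eval n Ψ noFree (fun _ => a) w) z =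
      ∑ l, edgeEval n (fun e => some (Function.update h e₀ l e)) (fun e => some (k e)) Ψ z := by
  have hc : ∀ (a : Fin n) (v : E → Fin n),
      (∀ e, Function.update (fun e => some (h e)) e₀ none e = none ∨ some (k e) = none →
        v e = a) ↔ v e₀ = a := fun a v => by
    constructor
    · exact fun H => H e₀ (by simp)
    · intro H e he
      by_cases hee : e = e₀
      · rwa [hee]
      · simp [hee] at he
  have key : ∀ a, dz n a (fun w => T.eval n Ψ noFree (fun _ => a) w) z =
      ∑ v : E → Fin n, (if v e₀ = a then 1 else 0) *
        ∑ l, ∏ j, edgeFactor n (fun e => some (Function.update h e₀ l e))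
          (fun e => some (k e)) Ψ v j z := fun a => by
    have H : (fun w => T.eval n Ψ noFree (fun _ => a) w) = _ := funext fun w =>
      P.eval_eq hΨ noFree (fun _ => a) (· = a) (fun i => i.elim0) (fun _ _ => Iff.rfl) w
    rw [H, dz_eq_dirOp, dirOp_sum_mul_prod _ _ _ _ _ (contDiff_edgeFactor _ _ hΨ), ← dz_eq_dirOp]
    refine Finset.sum_congr rfl fun v _ => ?_
    simp only [hc]
    split_ifs with hv
    · subst hv
      simp only [prod_edgeFactor_update_holo h _ e₀ hΨ]
    · simp
  simp only [key, edgeEval]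
  rw [Finset.sum_comm, Finset.sum_comm (s := (Finset.univ : Finset (Fin σ)))]
  simp

open Classical in
lemma EdgePresentation.sum_dzbar_eval {n : ℕ} {T : Term σ 1 0} {h k : E → Fin σ} {e₀ : E}
    (P : EdgePresentation T (fun e => some (h e))
      (Function.update (fun e => some (k e)) e₀ none))
    {Ψ : Fin σ → (Fin n → ℂ) → ℝ} (hΨ : ∀ j, SmoothCpt n (Ψ j)) (z : Fin n → ℂ) :
    ∑ a, dzbar n a (fun w => T.eval n Ψ (fun _ => a) noFree w) z =
      ∑ l, edgeEval n (fun e => some (h e)) (fun e => some (Function.update k e₀ l e)) Ψ z := by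
  have hc : ∀ (a : Fin n) (v : E → Fin n),
      (∀ e, some (h e) = none ∨ Function.update (fun e => some (k e)) e₀ none e = none →
        v e = a) ↔ v e₀ = a := fun a v => by
    constructor
    · exact fun H => H e₀ (by simp)
    · intro H e he
      by_cases hee : e = e₀
      · rwa [hee]
      · simp [hee] at he
  have key : ∀ a, dzbar n a (fun w => T.eval n Ψ (fun _ => a) noFree w) z =
      ∑ v : E → Fin n, (if v e₀ = a then 1 else 0) *
        ∑ l, ∏ j, edgeFactor n (fun e => some (h e))
          (fun e => some (Function.update k e₀ l e)) Ψ v j z := fun a => by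
    have H : (fun w => T.eval n Ψ (fun _ => a) noFree w) = _ := funext fun w =>
      P.eval_eq hΨ (fun _ => a) noFree (· = a) (fun _ _ => Iff.rfl) (fun i => i.elim0) w
    rw [H, dzbar_eq_dirOp, dirOp_sum_mul_prod _ _ _ _ _ (contDiff_edgeFactor _ _ hΨ),
      ← dzbar_eq_dirOp]
    refine Finset.sum_congr rfl fun v _ => ?_
    simp only [hc]
    split_ifs with hv
    · subst hv
      simp only [prod_edgeFactor_update_anti _ k e₀ hΨ]
    · simp
  simp only [key, edgeEval]
  rw [Finset.sum_comm, Finset.sum_comm (s := (Finset.univ : Finset (Fin σ)))]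
  simp

end Edges

/-! ### Linear combinations modulo divergences -/

lemma contDiff_eval {σ p q n : ℕ} (T : Term σ p q) {Ψ : Fin σ → (Fin n → ℂ) → ℝ}
    (hΨ : ∀ j, SmoothCpt n (Ψ j)) (fh : Fin p → Fin n) (fa : Fin q → Fin n) :
    ContDiff ℝ ∞ (fun w => T.eval n Ψ fh fa w) := by
  simp only [Term.eval, mixedDeriv_eq_multiDeriv _ _ (hΨ _).contDiff_ofReal]
  exact ContDiff.sum fun v _ => contDiff_const.mul
    (contDiff_prod fun j _ => contDiff_multiDeriv _ _ (hΨ j).contDiff_ofReal)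

namespace LinComb

variable {σ p q n : ℕ}

lemma contDiff_eval (L : LinComb σ p q) {Ψ : Fin σ → (Fin n → ℂ) → ℝ}
    (hΨ : ∀ j, SmoothCpt n (Ψ j)) (fh : Fin p → Fin n) (fa : Fin q → Fin n) :
    ContDiff ℝ ∞ (fun w => L.eval n Ψ fh fa w) :=
  ContDiff.sum fun i _ => contDiff_const.mul (KahlerInv.contDiff_eval (L.term i) hΨ fh fa)

/-- The empty linear combination. -/
def zero : LinComb σ p q := ⟨0, fun i => i.elim0, fun i => i.elim0⟩

/-- A single contraction with coefficient `1`. -/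
def single (T : Term σ p q) : LinComb σ p q := ⟨1, fun _ => 1, fun _ => T⟩

/-- The sum of two linear combinations. -/
def add (L M : LinComb σ p q) : LinComb σ p q :=
  ⟨L.N + M.N, Fin.append L.coeff M.coeff, Fin.append L.term M.term⟩

/-- The negative of a linear combination. -/
def neg (L : LinComb σ p q) : LinComb σ p q := ⟨L.N, fun i => -L.coeff i, L.term⟩

lemma forall_add {L M : LinComb σ p q} {P : Term σ p q → Prop} (hL : ∀ r, P (L.term r))
    (hM : ∀ r, P (M.term r)) (r : Fin (L.add M).N) : P ((L.add M).term r) :=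
  Fin.addCases (motive := fun r => P (Fin.append L.term M.term r))
    (fun r => by simpa using hL r) (fun r => by simpa using hM r) r

variable (Ψ : Fin σ → (Fin n → ℂ) → ℝ) (fh : Fin p → Fin n) (fa : Fin q → Fin n)
  (z : Fin n → ℂ)

lemma eval_zero : (zero : LinComb σ p q).eval n Ψ fh fa z = 0 := by
  exact Finset.sum_eq_zero fun i _ => i.elim0

lemma eval_single (T : Term σ p q) : (single T).eval n Ψ fh fa z = T.eval n Ψ fh fa z := by
  exact (Fin.sum_univ_one _).trans (one_mul _)

lemma eval_add (L M : LinComb σ p q) :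
    (L.add M).eval n Ψ fh fa z = L.eval n Ψ fh fa z + M.eval n Ψ fh fa z :=
  (Fin.sum_univ_add _).trans (by simp [add, eval])

lemma eval_neg (L : LinComb σ p q) : L.neg.eval n Ψ fh fa z = -L.eval n Ψ fh fa z := by
  simp only [eval, ← Finset.sum_neg_distrib, ← neg_mul]
  rfl

end LinComb

section Divergence

variable {σ n : ℕ} {Ψ : Fin σ → (Fin n → ℂ) → ℝ}

lemma divHolo_zero (z : Fin n → ℂ) : divHolo n (LinComb.zero : LinComb σ 1 0) Ψ z = 0 := by
  simp [divHolo, LinComb.eval_zero, dzbar]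

lemma divAnti_zero (z : Fin n → ℂ) : divAnti n (LinComb.zero : LinComb σ 0 1) Ψ z = 0 := by
  simp [divAnti, LinComb.eval_zero, dz]

lemma divHolo_neg (L : LinComb σ 1 0) (z : Fin n → ℂ) :
    divHolo n L.neg Ψ z = -divHolo n L Ψ z := by
  simp only [divHolo, LinComb.eval_neg, dzbar_eq_dirOp, dirOp_neg, Finset.sum_neg_distrib]

lemma divAnti_neg (L : LinComb σ 0 1) (z : Fin n → ℂ) :
    divAnti n L.neg Ψ z = -divAnti n L Ψ z := by
  simp only [divAnti, LinComb.eval_neg, dz_eq_dirOp, dirOp_neg, Finset.sum_neg_distrib]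

lemma divHolo_add (hΨ : ∀ j, SmoothCpt n (Ψ j)) (L M : LinComb σ 1 0) (z : Fin n → ℂ) :
    divHolo n (L.add M) Ψ z = divHolo n L Ψ z + divHolo n M Ψ z := by
  simp only [divHolo, LinComb.eval_add, dzbar_eq_dirOp,
    dirOp_add _ _ _ (L.contDiff_eval hΨ _ _) (M.contDiff_eval hΨ _ _), Finset.sum_add_distrib]

lemma divAnti_add (hΨ : ∀ j, SmoothCpt n (Ψ j)) (L M : LinComb σ 0 1) (z : Fin n → ℂ) :
    divAnti n (L.add M) Ψ z = divAnti n L Ψ z + divAnti n M Ψ z := by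
  simp only [divAnti, LinComb.eval_add, dz_eq_dirOp,
    dirOp_add _ _ _ (L.contDiff_eval hΨ _ _) (M.contDiff_eval hΨ _ _), Finset.sum_add_distrib]

end Divergence

/-- Up to divergences of `𝓛`-acceptable one-forms, `F` is a linear combination of complete
contractions satisfying `P`. -/
def ReducesTo {σ : ℕ} (n : ℕ) (𝓛 : RestrictionList σ) (P : Term σ 0 0 → Prop)
    (F : (Fin σ → (Fin n → ℂ) → ℝ) → (Fin n → ℂ) → ℂ) : Prop :=
  ∃ (Ta : LinComb σ 1 0) (Tb : LinComb σ 0 1) (L' : LinComb σ 0 0),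
    (∀ r, (Ta.term r).LAcc 𝓛) ∧ (∀ r, (Tb.term r).LAcc 𝓛) ∧ (∀ r, P (L'.term r)) ∧
    ∀ Ψ : Fin σ → (Fin n → ℂ) → ℝ, (∀ j, SmoothCpt n (Ψ j)) → ∀ z,
      F Ψ z = divHolo n Ta Ψ z + divAnti n Tb Ψ z + L'.eval n Ψ noFree noFree z

namespace ReducesTo

variable {σ n : ℕ} {𝓛 : RestrictionList σ} {P : Term σ 0 0 → Prop}
  {F G : (Fin σ → (Fin n → ℂ) → ℝ) → (Fin n → ℂ) → ℂ}

lemma congr (hF : ReducesTo n 𝓛 P F)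
    (h : ∀ Ψ : Fin σ → (Fin n → ℂ) → ℝ, (∀ j, SmoothCpt n (Ψ j)) → ∀ z, G Ψ z = F Ψ z) :
    ReducesTo n 𝓛 P G := by
  obtain ⟨Ta, Tb, L', ha, hb, hP, H⟩ := hF
  exact ⟨Ta, Tb, L', ha, hb, hP, fun Ψ hΨ z => (h Ψ hΨ z).trans (H Ψ hΨ z)⟩

lemma of_term {T : Term σ 0 0} (hT : P T) :
    ReducesTo n 𝓛 P fun Ψ z => T.eval n Ψ noFree noFree z :=
  ⟨.zero, .zero, .single T, fun r => r.elim0, fun r => r.elim0, fun _ => hT, fun Ψ _ z => by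
    rw [divHolo_zero, divAnti_zero, LinComb.eval_single, zero_add, zero_add]⟩

lemma zero : ReducesTo n 𝓛 P fun _ _ => 0 :=
  ⟨.zero, .zero, .zero, fun r => r.elim0, fun r => r.elim0, fun r => r.elim0, fun Ψ _ z => by
    rw [divHolo_zero, divAnti_zero, LinComb.eval_zero, zero_add, zero_add]⟩

lemma of_divHolo {T : Term σ 1 0} (hT : T.LAcc 𝓛) :
    ReducesTo n 𝓛 P fun Ψ z => ∑ a, dzbar n a (fun w => T.eval n Ψ (fun _ => a) noFree w) z :=
  ⟨.single T, .zero, .zero, fun _ => hT, fun r => r.elim0, fun r => r.elim0, fun Ψ _ z => by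
    rw [divAnti_zero, LinComb.eval_zero, add_zero, add_zero]
    simp only [divHolo, LinComb.eval_single]⟩

lemma of_divAnti {T : Term σ 0 1} (hT : T.LAcc 𝓛) :
    ReducesTo n 𝓛 P fun Ψ z => ∑ a, dz n a (fun w => T.eval n Ψ noFree (fun _ => a) w) z :=
  ⟨.zero, .single T, .zero, fun r => r.elim0, fun _ => hT, fun r => r.elim0, fun Ψ _ z => by
    rw [divHolo_zero, LinComb.eval_zero, zero_add, add_zero]
    simp only [divAnti, LinComb.eval_single]⟩

lemma add (hF : ReducesTo n 𝓛 P F) (hG : ReducesTo n 𝓛 P G) :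
    ReducesTo n 𝓛 P fun Ψ z => F Ψ z + G Ψ z := by
  obtain ⟨Ta, Tb, L, ha, hb, hP, H⟩ := hF
  obtain ⟨Ta', Tb', L', ha', hb', hP', H'⟩ := hG
  refine ⟨Ta.add Ta', Tb.add Tb', L.add L', LinComb.forall_add (P := (Term.LAcc · 𝓛)) ha ha',
    LinComb.forall_add (P := (Term.LAcc · 𝓛)) hb hb', LinComb.forall_add hP hP', fun Ψ hΨ z => ?_⟩
  simp only [H Ψ hΨ, H' Ψ hΨ, divHolo_add hΨ, divAnti_add hΨ, LinComb.eval_add]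
  ring

lemma neg (hF : ReducesTo n 𝓛 P F) : ReducesTo n 𝓛 P fun Ψ z => -F Ψ z := by
  obtain ⟨Ta, Tb, L, ha, hb, hP, H⟩ := hF
  refine ⟨Ta.neg, Tb.neg, L.neg, ha, hb, hP, fun Ψ hΨ z => ?_⟩
  simp only [H Ψ hΨ, divHolo_neg, divAnti_neg, LinComb.eval_neg]
  ring

lemma sum {ι : Type*} {s : Finset ι} {F : ι → (Fin σ → (Fin n → ℂ) → ℝ) → (Fin n → ℂ) → ℂ}
    (hF : ∀ i ∈ s, ReducesTo n 𝓛 P (F i)) : ReducesTo n 𝓛 P fun Ψ z => ∑ i ∈ s, F i Ψ z := by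
  classical
  induction s using Finset.induction_on with
  | empty => simpa using zero
  | insert i s hi ih =>
    simp only [Finset.sum_insert hi]
    exact (hF i (Finset.mem_insert_self i s)).add
      (ih fun j hj => hF j (Finset.mem_insert_of_mem hj))

end ReducesTo

/-! ### Moving one end of a trace -/

section Update

variable {σ : ℕ} {E : Type} [Fintype E]

open Classical in
lemma card_filter_update_none (h : E → Fin σ) (e₀ : E) :
    (Finset.univ.filter fun e =>
      Function.update (fun e => some (h e)) e₀ none e = none).card = 1 := by
  refine Finset.card_eq_one.2 ⟨e₀, ?_⟩
  ext e
  by_cases he : e = e₀ <;> simp [he]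

open Classical in
lemma le_card_filter_update {α : Fin σ → ℕ} {h : E → Fin σ} (e₀ : E)
    (hα : ∀ j, α j ≤ (Finset.univ.filter fun e => h e = j).card)
    (hlt : α (h e₀) < (Finset.univ.filter fun e => h e = h e₀).card)
    (o : Option (Fin σ)) (j : Fin σ) :
    α j ≤ (Finset.univ.filter fun e =>
      Function.update (fun e => some (h e)) e₀ o e = some j).card := by
  have hsub : (Finset.univ.filter fun e => h e = j).erase e₀ ⊆
      Finset.univ.filter fun e => Function.update (fun e => some (h e)) e₀ o e = some j := by
    intro e he
    rw [Finset.mem_erase, Finset.mem_filter] at he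
    simp [he.1, he.2.2]
  refine le_trans ?_ (Finset.card_le_card hsub)
  by_cases hj : h e₀ = j
  · subst hj
    exact (Nat.le_sub_one_of_lt hlt).trans Finset.pred_card_le_card_erase
  · rw [Finset.erase_eq_of_notMem (by simp [hj])]
    exact hα j

open Classical in
lemma card_trace_update_of_ne {h k : E → Fin σ} {e₀ : E} (he : h e₀ = k e₀) (l : Fin σ)
    {j : Fin σ} (hj : j ≠ k e₀) :
    (Finset.univ.filter fun e => Function.update h e₀ l e = j ∧ k e = j).card =
      (Finset.univ.filter fun e => h e = j ∧ k e = j).card := by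
  congr 1
  ext e
  by_cases hee : e = e₀
  · subst hee
    simp [Ne.symm hj]
  · simp [hee]

open Classical in
lemma card_trace_update_lt {h k : E → Fin σ} {e₀ : E} (he : h e₀ = k e₀) {l : Fin σ}
    (hl : l ≠ k e₀) :
    (Finset.univ.filter fun e => Function.update h e₀ l e = k e₀ ∧ k e = k e₀).card <
      (Finset.univ.filter fun e => h e = k e₀ ∧ k e = k e₀).card := by
  refine Finset.card_lt_card (Finset.ssubset_iff_subset_ne.2 ⟨fun e hm => ?_, fun heq => ?_⟩)
  · by_cases hee : e = e₀
    · subst hee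
      simp [he]
    · simpa [hee] using hm
  · have hm : e₀ ∈ Finset.univ.filter fun e => h e = k e₀ ∧ k e = k e₀ := by simp [he]
    rw [← heq] at hm
    simp [hl] at hm

lemma EdgePresentation.lAcc_iff {p q : ℕ} {T : Term σ p q} {h k : E → Option (Fin σ)}
    (P : EdgePresentation T h k) (𝓛 : RestrictionList σ) :
    T.LAcc 𝓛 ↔ (∀ j, 𝓛.α j ≤ (Finset.univ.filter fun e => h e = some j).card) ∧
      ∀ j, 𝓛.β j ≤ (Finset.univ.filter fun e => k e = some j).card := by
  simp only [Term.LAcc, P.A_eq, P.B_eq, forall_and]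

lemma reducesTo_edgeEval (n : ℕ) (𝓛 : RestrictionList σ) (i : Fin σ) (t : Fin σ → ℕ)
    (h k : E → Fin σ)
    (hα : ∀ j, 𝓛.α j ≤ (Finset.univ.filter fun e => h e = j).card)
    (hβ : ∀ j, 𝓛.β j ≤ (Finset.univ.filter fun e => k e = j).card)
    (ht : ∀ j, j ≠ i → (Finset.univ.filter fun e => h e = j ∧ k e = j).card = t j) :
    ReducesTo n 𝓛
      (fun T => T.LAcc 𝓛 ∧ ((T.A i = 𝓛.α i ∧ T.B i = 𝓛.β i) ∨ T.tracesAt i = 0) ∧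
        ∀ j, j ≠ i → T.tracesAt j = t j)
      (edgeEval n (fun e => some (h e)) (fun e => some (k e))) := by
  classical
  induction hN : (Finset.univ.filter fun e => h e = i ∧ k e = i).card using
    Nat.strong_induction_on generalizing h k with
  | _ N ih =>
  by_cases hdone : ((Finset.univ.filter fun e => h e = i).card = 𝓛.α i ∧
      (Finset.univ.filter fun e => k e = i).card = 𝓛.β i) ∨ N = 0
  · obtain ⟨T, ⟨P⟩⟩ := exists_edgePresentation (p := 0) (q := 0)
      (fun e => some (h e)) (fun e => some (k e)) (by simp) (by simp) (by simp)
    refine (ReducesTo.of_term (T := T) ⟨?_, ?_, ?_⟩).congr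
      fun Ψ hΨ z => (P.eval_complete hΨ z).symm
    · simpa [P.lAcc_iff] using ⟨hα, hβ⟩
    · simpa [P.A_eq, P.B_eq, P.tracesAt_eq, hN] using hdone
    · simpa [P.tracesAt_eq] using ht
  obtain ⟨hmin, hpos⟩ := not_or.1 hdone
  obtain ⟨e₀, he₀⟩ := Finset.card_pos.1 (hN ▸ Nat.pos_of_ne_zero hpos)
  simp only [Finset.mem_filter, Finset.mem_univ, true_and] at he₀
  obtain ⟨he, rfl⟩ := he₀
  by_cases hlt : 𝓛.α (k e₀) < (Finset.univ.filter fun e => h e = k e₀).card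
  · have hacc := le_card_filter_update e₀ hα (by rwa [he])
    obtain ⟨T, ⟨P⟩⟩ := exists_edgePresentation (p := 0) (q := 1)
      (Function.update (fun e => some (h e)) e₀ none) (fun e => some (k e))
      (card_filter_update_none _ e₀) (by simp) (by simp)
    have hT : T.LAcc 𝓛 := (P.lAcc_iff 𝓛).2 ⟨hacc none, by simpa using hβ⟩
    refine ((ReducesTo.of_divAnti hT).add (ReducesTo.sum (s := Finset.univ.erase (k e₀))
      fun l hl => ih _ ?_ (Function.update h e₀ l) k (fun j => ?_) hβ (fun j hj => ?_)
        rfl).neg).congr fun Ψ hΨ z => ?_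
    · rw [← hN]
      exact card_trace_update_lt he (Finset.ne_of_mem_erase hl)
    · refine (hacc (some l) j).trans_eq (congrArg Finset.card (Finset.filter_congr fun e _ => ?_))
      by_cases hee : e = e₀ <;> simp [hee]
    · rw [card_trace_update_of_ne he l hj, ht j hj]
    · rw [P.sum_dz_eval hΨ, ← Finset.add_sum_erase _ _ (Finset.mem_univ (k e₀)), ← he,
        Function.update_eq_self]
      ring
  · replace hlt : 𝓛.β (k e₀) < (Finset.univ.filter fun e => k e = k e₀).card :=
      lt_of_le_of_ne (hβ _) fun heq =>
        hmin ⟨le_antisymm (not_lt.1 hlt) (hα _), heq.symm⟩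
    have hacc := le_card_filter_update e₀ hβ hlt
    obtain ⟨T, ⟨P⟩⟩ := exists_edgePresentation (p := 1) (q := 0)
      (fun e => some (h e)) (Function.update (fun e => some (k e)) e₀ none)
      (by simp) (card_filter_update_none _ e₀) (by simp)
    have hT : T.LAcc 𝓛 := (P.lAcc_iff 𝓛).2 ⟨by simpa using hα, hacc none⟩
    refine ((ReducesTo.of_divHolo hT).add (ReducesTo.sum (s := Finset.univ.erase (k e₀))
      fun l hl => ih _ ?_ h (Function.update k e₀ l) hα (fun j => ?_) (fun j hj => ?_)
        rfl).neg).congr fun Ψ hΨ z => ?_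
    · rw [← hN, ← he]
      simp only [and_comm (a := h _ = _)]
      exact card_trace_update_lt he.symm (he ▸ Finset.ne_of_mem_erase hl)
    · refine (hacc (some l) j).trans_eq (congrArg Finset.card (Finset.filter_congr fun e _ => ?_))
      by_cases hee : e = e₀ <;> simp [hee]
    · rw [← ht j hj]
      simp only [and_comm (a := h _ = _)]
      exact card_trace_update_of_ne he.symm l (he ▸ hj)
    · rw [P.sum_dzbar_eval hΨ, ← Finset.add_sum_erase _ _ (Finset.mem_univ (k e₀)),
        Function.update_eq_self]
      ring

end Update

/-- Lemma 3.7: from a single `𝓛`-acceptable complete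
contraction whose factor on `ψ^i` is non-minimal and contains a trace, one
can subtract a divergence so that in every resulting term the factor on
`ψ^i` is minimal or trace-free, while the number of traces in every other
factor is unchanged. -/
theorem remove_trace_nonminimal {σ n : ℕ} (hσ : 0 < σ)
    (𝓛 : RestrictionList σ) (C : Term σ 0 0)
    (hacc : C.LAcc 𝓛) (i : Fin σ)
    (hnonmin : C.A i ≠ 𝓛.α i ∨ C.B i ≠ 𝓛.β i)
    (htrace : 1 ≤ C.tracesAt i) :
    ∃ (Ta : LinComb σ 1 0) (Tb : LinComb σ 0 1) (L' : LinComb σ 0 0),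
      (∀ r, (Ta.term r).LAcc 𝓛) ∧ (∀ r, (Tb.term r).LAcc 𝓛) ∧
      (∀ r, (L'.term r).LAcc 𝓛) ∧
      (∀ r, ((L'.term r).A i = 𝓛.α i ∧ (L'.term r).B i = 𝓛.β i) ∨
        (L'.term r).tracesAt i = 0) ∧
      (∀ r, ∀ j : Fin σ, j ≠ i → (L'.term r).tracesAt j = C.tracesAt j) ∧
      ∀ Ψ : Fin σ → (Fin n → ℂ) → ℝ, (∀ j, SmoothCpt n (Ψ j)) → ∀ z,
        C.eval n Ψ noFree noFree z - divHolo n Ta Ψ z - divAnti n Tb Ψ z =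
          L'.eval n Ψ noFree noFree z := by
  obtain ⟨h, k, ⟨P⟩⟩ := exists_presentation C
  have hA := (P.lAcc_iff 𝓛).1 hacc
  simp only [Option.some.injEq] at hA
  obtain ⟨Ta, Tb, L', ha, hb, hL, H⟩ :=
    reducesTo_edgeEval n 𝓛 i C.tracesAt h k hA.1 hA.2 fun j _ => by simp [P.tracesAt_eq]
  refine ⟨Ta, Tb, L', ha, hb, fun r => (hL r).1, fun r => (hL r).2.1, fun r => (hL r).2.2,
    fun Ψ hΨ z => ?_⟩
  rw [P.eval_complete hΨ, H Ψ hΨ]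
  ring

end KahlerInv
end
end
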